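/- For every integer n ≥ 1 there exists a map Ψ : ℝⁿ × [0,∞)^{n−1} → ℝⁿ × ℝ^{n−1} such that: the set S is closed; Ψ is a homeomorphism onto S (a topological embedding with image exactly S); the restriction of Ψ to the open subset ℝⁿ × (0,∞)^{n−1} is infinitely differentiable with injective Fréchet derivative at every point; and for every (s, t) ∈ ℝⁿ × [0,∞)^{n−1} and every k with 1 ≤ k ≤ n−1, the coordinate t_k equals 0 if and only if some sub-multiset T of roots(Ψ(s,t)) with card T = k has imaginary-part sum exactly k(k+1)/2. -/

import Mathlib

/-- Extend `b = (b₂, …, bₙ)` to `(b₁, …, bₙ)` with `b₁ = n(n+1)/2`. -/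
noncomputable def bExt (n : ℕ) (b : Fin (n - 1) → ℝ) : Fin n → ℝ := fun k =>
  if h : k.val = 0 then (n * (n + 1) : ℝ) / 2
  else b ⟨k.val - 1, by have := k.isLt; omega⟩

/-- The monic polynomial `P_{a,b}(z) = zⁿ + Σ_{k=1}^{n} (−1)^k (a_k + i b_k) z^{n−k}`. -/
noncomputable def gridPoly (n : ℕ) (a : Fin n → ℝ) (b : Fin (n - 1) → ℝ) : Polynomial ℂ :=
  Polynomial.X ^ n +
    ∑ k : Fin n,
      Polynomial.C ((-1 : ℂ) ^ (k.val + 1) * ((a k : ℂ) + (bExt n b k : ℂ) * Complex.I)) *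
        Polynomial.X ^ (n - (k.val + 1))

/-- The set `S = ψₙ((ℝⁿ × Πₙ)/Sₙ)`: points `(a, b)` such that every `k` of the roots of
`P_{a,b}`, counted with multiplicity, have imaginary parts summing to at least `k(k+1)/2`. -/
def permImage (n : ℕ) : Set ((Fin n → ℝ) × (Fin (n - 1) → ℝ)) :=
  {p | ∀ k : Fin (n - 1), ∀ T : Multiset ℂ,
    T ≤ (gridPoly n p.1 p.2).roots → Multiset.card T = k.val + 1 →
      ((k.val + 1) * (k.val + 2) : ℝ) / 2 ≤ (T.map Complex.im).sum}

section PartOne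

open Polynomial

/-- Continuant polynomials: characteristic polynomials of tridiagonal matrices. -/
noncomputable def contK (a t : ℕ → ℂ) : ℕ → Polynomial ℂ
  | 0 => 1
  | 1 => X - C (a 0)
  | (n + 2) => (X - C (a (n + 1))) * contK a t (n + 1) - C (t n) * contK a t n

theorem contK_monic_aux (a t : ℕ → ℂ) (n : ℕ) :
    ((contK a t n).Monic ∧ (contK a t n).natDegree = n) ∧
    ((contK a t (n + 1)).Monic ∧ (contK a t (n + 1)).natDegree = n + 1) := by
  induction n with
  | zero => simp [contK, monic_X_sub_C]
  | succ n ih =>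
    refine ⟨ih.2, ?_⟩
    obtain ⟨⟨h1, h2⟩, h3, h4⟩ := ih
    have hm : ((X - C (a (n + 1))) * contK a t (n + 1)).Monic := (monic_X_sub_C _).mul h3
    have hd : ((X - C (a (n + 1))) * contK a t (n + 1)).natDegree = n + 2 := by
      rw [(monic_X_sub_C _).natDegree_mul h3, h4, natDegree_X_sub_C]; ring
    have hlt : (C (t n) * contK a t n).degree < ((X - C (a (n + 1))) * contK a t (n + 1)).degree := by
      rw [degree_eq_natDegree hm.ne_zero, hd]
      refine lt_of_le_of_lt degree_le_natDegree ?_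
      have := natDegree_C_mul_le (t n) (contK a t n)
      rw [h2] at this
      exact_mod_cast (by omega)
    constructor
    · exact hm.sub_of_left hlt
    · have := natDegree_sub_eq_left_of_natDegree_lt
        (p := (X - C (a (n + 1))) * contK a t (n + 1)) (q := C (t n) * contK a t n) (by
          have := natDegree_C_mul_le (t n) (contK a t n)
          omega)
      rw [contK, this, hd]

theorem contK_monic (a t : ℕ → ℂ) (n : ℕ) : (contK a t n).Monic := (contK_monic_aux a t n).1.1
theorem contK_natDegree (a t : ℕ → ℂ) (n : ℕ) : (contK a t n).natDegree = n :=
  (contK_monic_aux a t n).1.2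

theorem contK_coeff_self (a t : ℕ → ℂ) (n : ℕ) : (contK a t n).coeff n = 1 := by
  have := contK_monic a t n
  rwa [Monic, leadingCoeff, contK_natDegree] at this

theorem contK_coeff_one (a t : ℕ → ℂ) (n : ℕ) :
    (contK a t (n + 1)).coeff n = - ∑ j ∈ Finset.range (n + 1), a j := by
  induction n with
  | zero => simp [contK]
  | succ n ih =>
    have h0 : (contK a t n).coeff (n + 1) = 0 :=
      coeff_eq_zero_of_natDegree_lt (by rw [contK_natDegree]; omega)
    rw [contK, coeff_sub, sub_mul, coeff_sub, coeff_X_mul, coeff_C_mul, coeff_C_mul, ih,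
      contK_coeff_self, h0, Finset.sum_range_succ _ (n + 1)]
    ring

theorem contK_coeff_two (a t : ℕ → ℂ) (n : ℕ) :
    (contK a t (n + 2)).coeff (n + 1) ^ 2 - 2 * (contK a t (n + 2)).coeff n =
      ∑ j ∈ Finset.range (n + 2), a j ^ 2 + 2 * ∑ j ∈ Finset.range (n + 1), t j := by
  induction n with
  | zero =>
    simp [contK, Finset.sum_range_succ, sub_mul, mul_sub, coeff_X, coeff_C]
    ring
  | succ n ih =>
    have h1 := contK_coeff_one a t (n + 1)
    have h2 := contK_coeff_one a t (n + 2)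
    have h3 : (contK a t (n + 3)).coeff (n + 1) = (contK a t (n + 2)).coeff n
        - a (n + 2) * (contK a t (n + 2)).coeff (n + 1) - t (n + 1) := by
      rw [contK, coeff_sub, sub_mul, coeff_sub, coeff_X_mul, coeff_C_mul, coeff_C_mul,
        contK_coeff_self]
      ring
    rw [Finset.sum_range_succ _ (n + 2)] at *
    rw [Finset.sum_range_succ _ (n + 1)] at *
    have h4 : (contK a t (n + 3)).coeff (n + 2) = (contK a t (n + 2)).coeff (n + 1) - a (n + 2) := by
      rw [h1, h2]; simp only [Finset.sum_range_succ]; ring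
    rw [show n + 1 + 2 = n + 3 from rfl, show n + 1 + 1 = n + 2 from rfl, h4, h3]
    have h5 := Finset.sum_range_succ t (n + 1)
    rw [show n + 1 + 1 = n + 2 from rfl] at h5
    linear_combination ih - 2 * h5

theorem contK_front_aux (n : ℕ) : ∀ (a t : ℕ → ℂ),
    contK a t (n + 2) = (X - C (a 0)) * contK (fun j => a (j + 1)) (fun j => t (j + 1)) (n + 1)
      - C (t 0) * contK (fun j => a (j + 2)) (fun j => t (j + 2)) n := by
  induction n using Nat.twoStepInduction with
  | zero => intro a t; simp [contK]; ring
  | one => intro a t; simp [contK]; ring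
  | more n h1 h2 =>
    intro a t
    rw [contK, h1, h2]
    rw [contK.eq_3 (fun j => a (j + 1)) _ (n + 1), contK.eq_3 (fun j => a (j + 2)) _ n]
    ring

theorem contK_split (a t : ℕ → ℂ) (k : ℕ) (hk : t k = 0) (m : ℕ) :
    contK a t (k + 1 + m) =
      contK a t (k + 1) * contK (fun j => a (k + 1 + j)) (fun j => t (k + 1 + j)) m := by
  induction m using Nat.twoStepInduction with
  | zero => simp [contK]
  | one =>
    rw [contK]
    rw [contK, hk]; simp; ring
  | more m h1 h2 =>
    rw [show k + 1 + (m + 2) = (k + 1 + m) + 2 by ring, contK, contK, h1,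
      show k + 1 + m + 1 = k + 1 + (m + 1) by ring, h2]
    ring

theorem contK_congr (a a' t t' : ℕ → ℂ) (n : ℕ) (ha : ∀ j < n, a j = a' j)
    (ht : ∀ j, j + 1 < n → t j = t' j) : contK a t n = contK a' t' n := by
  induction n using Nat.twoStepInduction with
  | zero => rfl
  | one => simp [contK, ha]
  | more n h1 h2 =>
    rw [contK, contK, h1 (fun j hj => ha j (by omega)) (fun j hj => ht j (by omega)),
      h2 (fun j hj => ha j (by omega)) (fun j hj => ht j (by omega)), ha (n + 1) (by omega),
      ht n (by omega)]

end PartOne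

section PartTwo

open Polynomial Matrix

/-- Tridiagonal matrix with diagonal `a`, superdiagonal `1`, subdiagonal `t`. -/
noncomputable def triM (n : ℕ) (a t : ℕ → ℂ) : Matrix (Fin n) (Fin n) ℂ := fun j k =>
  if j.val = k.val then a j.val else if j.val + 1 = k.val then 1
  else if j.val = k.val + 1 then t k.val else 0

theorem trace_mul_herm_im {n : Type*} [Fintype n] (P Q : Matrix n n ℂ) (hP : P.IsHermitian)
    (hQ : Q.IsHermitian) : (trace (P * Q)).im = 0 := by
  have h : star (trace (P * Q)) = trace (P * Q) := by
    rw [← trace_conjTranspose, conjTranspose_mul, hP.eq, hQ.eq, trace_mul_comm]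
  exact Complex.conj_eq_iff_im.mp h

theorem triM_left_herm (n : ℕ) (s t : ℕ → ℝ) (ht : ∀ j, j + 1 < n → 0 < t j) :
    (diagonal (fun j : Fin n => (((∏ i ∈ Finset.range j.val, t i)⁻¹ : ℝ) : ℂ)) *
      triM n (fun j => (s j : ℂ)) (fun j => (t j : ℂ))).IsHermitian := by
  ext j k
  rw [conjTranspose_apply, diagonal_mul, diagonal_mul]
  obtain ⟨j, hj⟩ := j
  obtain ⟨k, hk⟩ := k
  simp only [triM]
  rcases lt_trichotomy j k with h | h | h
  · by_cases h' : j + 1 = k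
    · subst h'
      have := (ht j hk).ne'
      have h2 : (t j : ℂ) ≠ 0 := by exact_mod_cast this
      simp [Finset.prod_range_succ, show ¬ (j + 1 + 1 = j) by omega]
      try field_simp
    · rw [if_neg (by omega), if_neg (by omega), if_neg (by omega), if_neg (by omega),
        if_neg (by omega), if_neg (by omega)]; simp
  · subst h; simp
  · by_cases h' : k + 1 = j
    · subst h'
      have := (ht k hj).ne'
      have h2 : (t k : ℂ) ≠ 0 := by exact_mod_cast this
      simp [Finset.prod_range_succ, show ¬ (k + 1 + 1 = k) by omega]
      try field_simp
    · rw [if_neg (by omega), if_neg (by omega), if_neg (by omega), if_neg (by omega),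
        if_neg (by omega), if_neg (by omega)]; simp

theorem triM_right_herm (n : ℕ) (s t : ℕ → ℝ) :
    (triM n (fun j => (s j : ℂ)) (fun j => (t j : ℂ)) *
      diagonal (fun j : Fin n => (((∏ i ∈ Finset.range j.val, t i) : ℝ) : ℂ))).IsHermitian := by
  ext j k
  rw [conjTranspose_apply, mul_diagonal, mul_diagonal]
  obtain ⟨j, hj⟩ := j
  obtain ⟨k, hk⟩ := k
  simp only [triM]
  rcases lt_trichotomy j k with h | h | h
  · by_cases h' : j + 1 = k
    · subst h'
      simp [Finset.prod_range_succ, show ¬ (j + 1 + 1 = j) by omega]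
      try ring
    · rw [if_neg (by omega), if_neg (by omega), if_neg (by omega), if_neg (by omega),
        if_neg (by omega), if_neg (by omega)]; simp
  · subst h; simp
  · by_cases h' : k + 1 = j
    · subst h'
      simp [Finset.prod_range_succ, show ¬ (k + 1 + 1 = k) by omega]
      try ring
    · rw [if_neg (by omega), if_neg (by omega), if_neg (by omega), if_neg (by omega),
        if_neg (by omega), if_neg (by omega)]; simp

theorem triM_decomp (n : ℕ) (s t d : ℕ → ℝ) :
    triM n (fun j => (s j : ℂ) + (d j : ℂ) * Complex.I) (fun j => (t j : ℂ)) =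
      triM n (fun j => (s j : ℂ)) (fun j => (t j : ℂ)) +
        diagonal (fun j : Fin n => (d j.val : ℂ) * Complex.I) := by
  ext j k
  rw [Matrix.add_apply, diagonal_apply]
  by_cases h : j = k
  · subst h; simp [triM]
  · have : j.val ≠ k.val := fun h' => h (Fin.ext h')
    simp [triM, h, this]

theorem tri_energy (n : ℕ) (s s' t t' d : ℕ → ℝ)
    (ht' : ∀ j, j + 1 < n → 0 < t' j) (Z : Matrix (Fin n) (Fin n) ℂ) :
    (∑ j : Fin n, ∑ k : Fin n, star (Z j k) *
      ((((∏ i ∈ Finset.range j.val, t' i)⁻¹ : ℝ) : ℂ) *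
      (triM n (fun j => (s' j : ℂ) + (d j : ℂ) * Complex.I) (fun j => (t' j : ℂ)) * Z -
        Z * triM n (fun j => (s j : ℂ) + (d j : ℂ) * Complex.I) (fun j => (t j : ℂ))) j k *
      (((∏ i ∈ Finset.range k.val, t i) : ℝ) : ℂ))).im =
    ∑ j : Fin n, ∑ k : Fin n, (∏ i ∈ Finset.range j.val, t' i)⁻¹ * (∏ i ∈ Finset.range k.val, t i)
      * (d j.val - d k.val) * Complex.normSq (Z j k) := by
  set H := diagonal (fun j : Fin n => (((∏ i ∈ Finset.range j.val, t' i)⁻¹ : ℝ) : ℂ)) with hH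
  set G := diagonal (fun j : Fin n => (((∏ i ∈ Finset.range j.val, t i) : ℝ) : ℂ)) with hG
  set X' := triM n (fun j => (s' j : ℂ)) (fun j => (t' j : ℂ)) with hX'
  set X := triM n (fun j => (s j : ℂ)) (fun j => (t j : ℂ)) with hX
  set D := diagonal (fun j : Fin n => (d j.val : ℂ) * Complex.I) with hD
  have h1 : (H * X').IsHermitian := triM_left_herm n s' t' ht'
  have h2 : (X * G).IsHermitian := triM_right_herm n s t
  have hHh : H.IsHermitian := by
    rw [hH]; exact isHermitian_diagonal_of_self_adjoint _ (by ext; simp)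
  have hGh : G.IsHermitian := by
    rw [hG]; exact isHermitian_diagonal_of_self_adjoint _ (by ext; simp)
  rw [triM_decomp, triM_decomp, ← hX, ← hX', ← hD]
  have e1 : (trace (Zᴴ * (H * (X' * Z - Z * X) * G))).im = 0 := by
    have : Zᴴ * (H * (X' * Z - Z * X) * G) = Zᴴ * ((H * X') * (Z * G)) - (Zᴴ * H * Z) * (X * G) := by
      noncomm_ring
    rw [this, trace_sub, Complex.sub_im, trace_mul_comm, Matrix.mul_assoc,
      trace_mul_herm_im _ _ h1, trace_mul_herm_im _ _ _ h2, sub_zero]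
    · exact isHermitian_conjTranspose_mul_mul Z hHh
    · exact isHermitian_mul_mul_conjTranspose Z hGh
  have e2 : ((X' + D) * Z - Z * (X + D)) = (X' * Z - Z * X) + (D * Z - Z * D) := by noncomm_ring
  rw [e2]
  have e3 : ∀ W : Matrix (Fin n) (Fin n) ℂ, trace (Zᴴ * (H * W * G)) =
      ∑ j : Fin n, ∑ k : Fin n, star (Z j k) *
      ((((∏ i ∈ Finset.range j.val, t' i)⁻¹ : ℝ) : ℂ) * W j k *
      (((∏ i ∈ Finset.range k.val, t i) : ℝ) : ℂ)) := by
    intro W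
    rw [trace, Finset.sum_comm]
    refine Finset.sum_congr rfl fun k _ => ?_
    rw [diag_apply, mul_apply]
    refine Finset.sum_congr rfl fun j _ => ?_
    rw [conjTranspose_apply, hG, mul_diagonal, hH, diagonal_mul]
  rw [← e3, Matrix.mul_add, Matrix.add_mul, Matrix.mul_add, trace_add, Complex.add_im, e1, zero_add, e3,
    Complex.im_sum]
  refine Finset.sum_congr rfl fun j _ => ?_
  rw [Complex.im_sum]
  refine Finset.sum_congr rfl fun k _ => ?_
  rw [Matrix.sub_apply, hD, diagonal_mul, mul_diagonal]
  have : star (Z j k) * ((((∏ i ∈ Finset.range j.val, t' i)⁻¹ : ℝ) : ℂ) * ((d j.val : ℂ) * Complex.I * Z j k - Z j k * ((d k.val : ℂ) * Complex.I)) *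
      (((∏ i ∈ Finset.range k.val, t i) : ℝ) : ℂ)) = (((∏ i ∈ Finset.range j.val, t' i)⁻¹ * (∏ i ∈ Finset.range k.val, t i)
      * (d j.val - d k.val) * Complex.normSq (Z j k) : ℝ) : ℂ) * Complex.I := by
    push_cast
    rw [Complex.normSq_eq_conj_mul_self]
    simp only [Complex.star_def]
    ring
  rw [this]; simp only [Complex.mul_im, Complex.ofReal_re, Complex.ofReal_im, Complex.I_re, Complex.I_im]; ring

theorem triM_zero (n : ℕ) (a t : ℕ → ℂ) (j k : Fin n) (h1 : j.val ≠ k.val)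
    (h2 : j.val + 1 ≠ k.val) (h3 : j.val ≠ k.val + 1) : triM n a t j k = 0 := by
  simp [triM, h1, h2, h3]

theorem core_mat (n : ℕ) (s s' t t' d : ℕ → ℝ) (hd : StrictMono d)
    (ht : ∀ j, j + 1 < n → 0 < t j)
    (ht' : ∀ j, j + 1 < n → 0 < t' j) (Y B : Matrix (Fin n) (Fin n) ℂ)
    (hB : triM n (fun j => (s' j : ℂ) + (d j : ℂ) * Complex.I) (fun j => (t' j : ℂ)) * Y -
        Y * triM n (fun j => (s j : ℂ) + (d j : ℂ) * Complex.I) (fun j => (t j : ℂ)) = B)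
    (hBre : ∀ j k, (B j k).im = 0)
    (hBsupp : ∀ j k : Fin n, j.val ≠ k.val → j.val ≠ k.val + 1 → B j k = 0)
    (hY1 : ∀ j k : Fin n, j.val + 1 = k.val → Y j k = 0)
    (hY0 : ∀ j : Fin n, j.val = 0 → Y j j = 0) : Y = 0 := by
  have hpos : ∀ j : Fin n, 0 < ∏ i ∈ Finset.range j.val, t i := fun j =>
    Finset.prod_pos fun i hi => ht i (by have := Finset.mem_range.mp hi; omega)
  have hpos' : ∀ j : Fin n, 0 < (∏ i ∈ Finset.range j.val, t' i)⁻¹ := fun j =>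
    inv_pos.mpr (Finset.prod_pos fun i hi => ht' i (by have := Finset.mem_range.mp hi; omega))
  set A := triM n (fun j => (s j : ℂ) + (d j : ℂ) * Complex.I) (fun j => (t j : ℂ)) with hA
  set A' := triM n (fun j => (s' j : ℂ) + (d j : ℂ) * Complex.I) (fun j => (t' j : ℂ)) with hA'
  have up : ∀ j k : Fin n, j.val < k.val → Y j k = 0 := by
    set Z : Matrix (Fin n) (Fin n) ℂ := fun j k => if j.val < k.val then Y j k else 0 with hZ
    have hZ1 : ∀ j k : Fin n, j.val < k.val → Z j k = Y j k := fun j k h => if_pos h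
    have hZ0 : ∀ j k : Fin n, ¬ j.val < k.val → Z j k = 0 := fun j k h => if_neg h
    have hE := tri_energy n s s' t t' d ht' Z
    rw [← hA, ← hA'] at hE
    have hzero : ∀ j k : Fin n, star (Z j k) *
      ((((∏ i ∈ Finset.range j.val, t' i)⁻¹ : ℝ) : ℂ) * (A' * Z - Z * A) j k *
      (((∏ i ∈ Finset.range k.val, t i) : ℝ) : ℂ)) = 0 := by
      intro j k
      by_cases h1 : j.val + 1 < k.val
      · have : (A' * Z - Z * A) j k = (A' * Y - Y * A) j k := by
          rw [Matrix.sub_apply, Matrix.sub_apply, mul_apply, mul_apply, mul_apply, mul_apply]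
          congr 1
          · refine Finset.sum_congr rfl fun i _ => ?_
            by_cases hi : i.val < k.val
            · rw [hZ1 _ _ hi]
            · rw [hA', triM_zero _ _ _ _ _ (by omega) (by omega) (by omega)]; simp
          · refine Finset.sum_congr rfl fun i _ => ?_
            by_cases hi : j.val < i.val
            · rw [hZ1 _ _ hi]
            · rw [hA, triM_zero _ _ _ _ _ (by omega) (by omega) (by omega)]; simp
        rw [this, hB, hBsupp j k (by omega) (by omega)]; simp
      · have : Z j k = 0 := by
          simp only [hZ]
          split_ifs with h
          · exact hY1 j k (by omega)
          · rfl
        rw [this]; simp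
    rw [Finset.sum_eq_zero (fun j _ => Finset.sum_eq_zero fun k _ => hzero j k)] at hE
    have hnn : ∀ j k : Fin n, (∏ i ∈ Finset.range j.val, t' i)⁻¹ * (∏ i ∈ Finset.range k.val, t i)
      * (d j.val - d k.val) * Complex.normSq (Z j k) ≤ 0 := by
      intro j k
      by_cases h : j.val < k.val
      · have h1 := hd h
        have h2 := mul_pos (hpos' j) (hpos k)
        have h3 := Complex.normSq_nonneg (Z j k)
        exact mul_nonpos_of_nonpos_of_nonneg (mul_nonpos_of_nonneg_of_nonpos h2.le (by linarith)) h3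
      · simp [hZ0 _ _ h]
    have hE' := hE.symm
    rw [Complex.zero_im, Finset.sum_eq_zero_iff_of_nonpos
      (fun j _ => Finset.sum_nonpos fun k _ => hnn j k)] at hE'
    intro j k hjk
    have h1 := hE' j (Finset.mem_univ _)
    rw [Finset.sum_eq_zero_iff_of_nonpos (fun k _ => hnn j k)] at h1
    have h2 := h1 k (Finset.mem_univ _)
    have h3 := mul_pos (hpos' j) (hpos k)
    have h4 := hd hjk
    have h5 : Complex.normSq (Z j k) = 0 := by
      rcases mul_eq_zero.mp h2 with h | h
      · rcases mul_eq_zero.mp h with h | h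
        · exact absurd h h3.ne'
        · linarith
      · exact h
    rw [Complex.normSq_eq_zero] at h5
    rwa [hZ1 _ _ hjk] at h5
  have diag0 : ∀ m (hm : m < n), Y ⟨m, hm⟩ ⟨m, hm⟩ = 0 := by
    intro m
    induction m with
    | zero => intro hm; exact hY0 _ rfl
    | succ m ih =>
      intro hm
      have ih := ih (by omega)
      have h := congrFun (congrFun hB ⟨m, by omega⟩) ⟨m + 1, hm⟩
      rw [hBsupp _ _ (by simp) (by simp; omega), Matrix.sub_apply, mul_apply, mul_apply,
        Finset.sum_eq_single ⟨m + 1, hm⟩, Finset.sum_eq_single ⟨m, by omega⟩, ih] at h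
      · simpa [hA', triM] using h
      · intro i _ hi
        have : i.val ≠ m := fun h => hi (Fin.ext h)
        by_cases h' : i.val < m
        · rw [hA, triM_zero _ _ _ _ _ (by simp; omega) (by simp; omega) (by simp; omega)]; simp
        · rw [up _ _ (by simp; omega)]; simp
      · simp
      · intro i _ hi
        have : i.val ≠ m + 1 := fun h => hi (Fin.ext h)
        by_cases h' : i.val < m + 1
        · rw [up _ _ (by simp; omega)]; simp
        · rw [hA', triM_zero _ _ _ _ _ (by simp; omega) (by simp; omega) (by simp; omega)]; simp
      · simp
  have up0 : ∀ j k : Fin n, j.val ≤ k.val → Y j k = 0 := by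
    intro j k hjk
    rcases hjk.lt_or_eq with h | h
    · exact up j k h
    · have : j = k := Fin.ext h
      subst this; exact diag0 j.val j.isLt
  have sub1 : ∀ m (hm : m + 1 < n), (Y ⟨m + 1, hm⟩ ⟨m, by omega⟩).im = 0 := by
    intro m
    induction m with
    | zero =>
      intro hm
      have h := congrArg Complex.im (congrFun (congrFun hB ⟨0, by omega⟩) ⟨0, by omega⟩)
      rw [hBre, Matrix.sub_apply, mul_apply, mul_apply,
        Finset.sum_eq_single ⟨1, hm⟩, Finset.sum_eq_zero] at h
      · simpa [hA', triM] using h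
      · intro i _
        rw [up0 _ _ (by simp)]; simp
      · intro i _ hi
        have : i.val ≠ 1 := fun h => hi (Fin.ext h)
        by_cases h' : i.val < 1
        · rw [up0 _ _ (by simp; omega)]; simp
        · rw [hA', triM_zero _ _ _ _ _ (by simp; omega) (by simp; omega) (by simp)]; simp
      · simp
    | succ m ih =>
      intro hm
      have ih := ih (by omega)
      have h := congrArg Complex.im (congrFun (congrFun hB ⟨m + 1, by omega⟩) ⟨m + 1, by omega⟩)
      rw [hBre, Matrix.sub_apply, mul_apply, mul_apply,
        Finset.sum_eq_single ⟨m + 2, hm⟩, Finset.sum_eq_single ⟨m, by omega⟩] at h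
      · simpa [hA', hA, triM, ih] using h
      · intro i _ hi
        have : i.val ≠ m := fun h => hi (Fin.ext h)
        by_cases h' : i.val < m
        · rw [hA, triM_zero _ _ _ _ _ (by simp; omega) (by simp; omega) (by simp; omega)]; simp
        · rw [up0 _ _ (by simp; omega)]; simp
      · simp
      · intro i _ hi
        have : i.val ≠ m + 2 := fun h => hi (Fin.ext h)
        by_cases h' : i.val < m + 2
        · rw [up0 _ _ (by simp; omega)]; simp
        · rw [hA', triM_zero _ _ _ _ _ (by simp; omega) (by simp; omega) (by simp; omega)]; simp
      · simp
  have hE := tri_energy n s s' t t' d ht' Y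
  rw [← hA, ← hA', hB, Complex.im_sum, Finset.sum_eq_zero] at hE
  · have hnn : ∀ j k : Fin n, 0 ≤ (∏ i ∈ Finset.range j.val, t' i)⁻¹ * (∏ i ∈ Finset.range k.val, t i)
      * (d j.val - d k.val) * Complex.normSq (Y j k) := by
      intro j k
      by_cases h : j.val ≤ k.val
      · simp [up0 j k h]
      · have h1 := hd (not_le.mp h)
        have h2 := mul_pos (hpos' j) (hpos k)
        have h3 := Complex.normSq_nonneg (Y j k)
        exact mul_nonneg (mul_nonneg h2.le (by linarith)) h3
    have hE' := hE.symm
    rw [Finset.sum_eq_zero_iff_of_nonneg (fun j _ => Finset.sum_nonneg fun k _ => hnn j k)] at hE'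
    ext j k
    by_cases hjk : j.val ≤ k.val
    · exact up0 j k hjk
    have h1 := hE' j (Finset.mem_univ _)
    rw [Finset.sum_eq_zero_iff_of_nonneg (fun k _ => hnn j k)] at h1
    have h2 := h1 k (Finset.mem_univ _)
    have h3 := mul_pos (hpos' j) (hpos k)
    have h4 := hd (not_le.mp hjk)
    rcases mul_eq_zero.mp h2 with h | h
    · rcases mul_eq_zero.mp h with h | h
      · exact absurd h h3.ne'
      · linarith
    · simpa using h
  · intro j _
    rw [Complex.im_sum, Finset.sum_eq_zero]
    intro k _
    by_cases h : j.val = k.val + 1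
    · have hyr : (Y j k).im = 0 := by
        obtain ⟨j, hj⟩ := j
        obtain ⟨k, hk⟩ := k
        simp only at h; subst h
        exact sub1 k hj
      simp [Complex.mul_im, hyr, hBre, -Complex.ofReal_prod, -Complex.ofReal_inv]
    · by_cases h' : j.val = k.val
      · simp [up0 j k h'.le]
      · simp [hBsupp j k h' h]


theorem triM_split (n : ℕ) (a t : ℕ → ℂ) (j i : Fin n) (x : ℂ) :
    triM n a t j i * x = (if i.val = j.val then a j.val * x else 0) +
      (if i.val = j.val + 1 then x else 0) + (if i.val + 1 = j.val then t i.val * x else 0) := by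
  unfold triM
  rcases lt_trichotomy j.val i.val with h | h | h
  · by_cases h' : j.val + 1 = i.val
    · simp [h'.symm, show ¬ (j.val + 1 + 1 = j.val) by omega]
    · simp [h', show ¬ j.val = i.val by omega, show ¬ i.val = j.val by omega,
        show ¬ i.val = j.val + 1 by omega, show ¬ j.val = i.val + 1 by omega,
        show ¬ i.val + 1 = j.val by omega]
  · simp [h]
  · by_cases h' : i.val + 1 = j.val
    · simp [h'.symm, show ¬ (i.val + 1 + 1 = i.val) by omega,
        show ¬ (i.val = i.val + 1 + 1) by omega]
    · simp [h', show ¬ j.val = i.val by omega, show ¬ i.val = j.val by omega,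
        show ¬ i.val = j.val + 1 by omega, show ¬ j.val = i.val + 1 by omega,
        show ¬ j.val + 1 = i.val by omega]

theorem sum_fin_ite (n : ℕ) (φ : ℕ → ℂ) (m : ℕ) (c : ℂ) :
    ∑ i : Fin n, (if i.val = m then c * φ i.val else 0) = if m < n then c * φ m else 0 := by
  rw [Fin.sum_univ_eq_sum_range (fun i => if i = m then c * φ i else 0) n]
  simp [Finset.sum_ite_eq']

theorem triM_row_zero (n : ℕ) (a t : ℕ → ℂ) (φ : ℕ → ℂ) (hφ : φ n = 0) (j : Fin n) (hj : j.val = 0) :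
    ∑ i : Fin n, triM n a t j i * φ i.val = a 0 * φ 0 + φ 1 := by
  have hn : 0 < n := by have := j.isLt; omega
  simp_rw [triM_split]
  rw [Finset.sum_add_distrib, Finset.sum_add_distrib, sum_fin_ite n φ]
  have h1 := sum_fin_ite n φ (j.val + 1) 1
  simp only [one_mul] at h1
  rw [h1, hj]
  simp only [hn, if_true]
  have : (if 0 + 1 < n then φ (0 + 1) else 0) = φ 1 := by
    split_ifs with h
    · rfl
    · have : n = 1 := by omega
      subst this; exact hφ.symm
  rw [this]
  simp

theorem triM_row_succ (n : ℕ) (a t : ℕ → ℂ) (φ : ℕ → ℂ) (hφ : φ n = 0) (j : Fin n) (m : ℕ)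
    (hj : j.val = m + 1) :
    ∑ i : Fin n, triM n a t j i * φ i.val = a (m + 1) * φ (m + 1) + φ (m + 2) + t m * φ m := by
  have hn : m + 1 < n := by have := j.isLt; omega
  simp_rw [triM_split]
  rw [Finset.sum_add_distrib, Finset.sum_add_distrib, sum_fin_ite n φ]
  have h1 := sum_fin_ite n φ (j.val + 1) 1
  simp only [one_mul] at h1
  have h2 := sum_fin_ite n (fun i => t i * φ i) m 1
  simp only [one_mul] at h2
  rw [h1, hj]
  have h3 : ∀ i : Fin n, (i.val + 1 = m + 1) = (i.val = m) := fun i => by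
    apply propext; omega
  simp_rw [h3]
  rw [h2]
  have : (if m + 1 + 1 < n then φ (m + 1 + 1) else 0) = φ (m + 2) := by
    split_ifs with h
    · rfl
    · have : n = m + 2 := by omega
      subst this; exact hφ.symm
  rw [this, if_pos hn, if_pos (by omega)]

/-- basis row vectors, extended by zero. -/
noncomputable def eRow (n : ℕ) (j : ℕ) : Fin n → ℂ := fun k => if k.val = j then 1 else 0

theorem eRow_n (n : ℕ) : eRow n n = 0 := by
  ext k; simp [eRow, k.isLt.ne]

theorem eRow_vecMul (n : ℕ) (M : Matrix (Fin n) (Fin n) ℂ) (j : Fin n) :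
    eRow n j.val ᵥ* M = M j := by
  ext k
  simp [eRow, vecMul, dotProduct, Fin.val_inj]

theorem triM_row0_eq (n : ℕ) (a t : ℕ → ℂ) (h : 0 < n) :
    triM n a t ⟨0, h⟩ = a 0 • eRow n 0 + eRow n 1 := by
  ext k
  have := triM_split n a t ⟨0, h⟩ k 1
  rw [mul_one] at this
  rw [this]
  simp [eRow]

theorem triM_rowS_eq (n : ℕ) (a t : ℕ → ℂ) (m : ℕ) (h : m + 1 < n) :
    triM n a t ⟨m + 1, h⟩ = a (m + 1) • eRow n (m + 1) + eRow n (m + 2) + t m • eRow n m := by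
  ext k
  have := triM_split n a t ⟨m + 1, h⟩ k 1
  rw [mul_one] at this
  rw [this]
  by_cases hk : k.val = m
  · simp [eRow, hk]; omega
  · simp [eRow, hk]

theorem eRow_contK (n : ℕ) (a t : ℕ → ℂ) (hn : 0 < n) (j : ℕ) (hj : j ≤ n) :
    eRow n 0 ᵥ* aeval (triM n a t) (contK a t j) = eRow n j := by
  induction j using Nat.twoStepInduction with
  | zero => simp [contK]
  | one =>
    have h1 := eRow_vecMul n (triM n a t) ⟨0, hn⟩
    rw [triM_row0_eq] at h1
    simp only at h1
    rw [contK, map_sub, aeval_X, aeval_C, vecMul_sub, h1, Algebra.algebraMap_eq_smul_one,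
      vecMul_smul, vecMul_one]
    abel
  | more m h1 h2 =>
    have h1 := h1 (by omega)
    have h2 := h2 (by omega)
    have h3 := eRow_vecMul n (triM n a t) ⟨m + 1, by omega⟩
    rw [triM_rowS_eq] at h3
    simp only at h3
    rw [contK, mul_comm, map_sub, map_mul, map_mul, map_sub, aeval_X, aeval_C, aeval_C, vecMul_sub,
      ← vecMul_vecMul, h2, vecMul_sub, h3, Algebra.algebraMap_eq_smul_one,
      Algebra.algebraMap_eq_smul_one, smul_mul_assoc, one_mul, vecMul_smul, vecMul_smul,
      vecMul_one, h1]
    abel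

theorem aeval_contK (n : ℕ) (a t : ℕ → ℂ) (hn : 0 < n) :
    aeval (triM n a t) (contK a t n) = 0 := by
  ext j k
  have h1 := eRow_vecMul n (aeval (triM n a t) (contK a t n)) j
  rw [← h1, ← eRow_contK n a t hn j.val j.isLt.le, vecMul_vecMul, ← map_mul, mul_comm, map_mul,
    ← vecMul_vecMul, eRow_contK n a t hn n le_rfl, eRow_n, zero_vecMul]
  rfl

theorem core_poly_mat (n : ℕ) (hn : 0 < n) (a a' t t' β γ : ℕ → ℂ)
    (hK : contK a' t' n = contK a t n) (g : ℕ → Polynomial ℂ) (g0 : g 0 = 0) (g1 : g 1 = C (β 0))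
    (grec : ∀ j, g (j + 2) = (X - C (a' (j + 1))) * g (j + 1) - C (t' j) * g j
      + C (β (j + 1)) * contK a t (j + 1) + C (γ j) * contK a t j) (gn : g n = 0) (v : Fin n → ℂ)
    (Y : Matrix (Fin n) (Fin n) ℂ)
    (hY : ∀ j : Fin n, Y j = eRow n 0 ᵥ* aeval (triM n a t) (g j.val) +
      v ᵥ* aeval (triM n a t) (contK a' t' j.val)) :
    triM n a' t' * Y - Y * triM n a t = fun j k =>
      β j.val * eRow n j.val k + if j.val = 0 then 0 else γ (j.val - 1) * eRow n (j.val - 1) k := by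
  set A := triM n a t with hA
  set y : ℕ → Fin n → ℂ := fun j => eRow n 0 ᵥ* aeval A (g j) + v ᵥ* aeval A (contK a' t' j) with hy
  have hyn : y n = 0 := by
    simp only [hy]
    rw [gn, hK, hA, aeval_contK n a t hn]; simp
  ext j k
  have hYA : (Y * A) j k = (y j.val ᵥ* A) k := by
    rw [mul_apply_eq_vecMul, hY]
  have hA'Y : (triM n a' t' * Y) j k = ∑ i : Fin n, triM n a' t' j i * (y i.val k) := by
    rw [mul_apply]
    refine Finset.sum_congr rfl fun i _ => ?_
    rw [hY]
  rw [Matrix.sub_apply, hYA, hA'Y]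
  rcases hm : j.val with _ | m
  · rw [triM_row_zero n a' t' (fun i => y i k) (by simp [hyn]) j hm]
    have h1 : y 1 = y 0 ᵥ* A - a' 0 • y 0 + β 0 • eRow n 0 := by
      simp only [hy]
      rw [g0, g1, contK, contK, map_sub, aeval_X, aeval_C, aeval_C]
      simp only [map_zero, map_one, vecMul_zero, vecMul_one, zero_add,
        Algebra.algebraMap_eq_smul_one, vecMul_smul, vecMul_sub]
      abel
    rw [h1]
    simp
    ring
  · rw [triM_row_succ n a' t' (fun i => y i k) (by simp [hyn]) j m hm]
    have h1 : y (m + 2) = y (m + 1) ᵥ* A - a' (m + 1) • y (m + 1) - t' m • y m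
        + β (m + 1) • eRow n (m + 1) + γ m • eRow n m := by
      have e1 : eRow n 0 ᵥ* aeval A (contK a t (m + 1)) = eRow n (m + 1) :=
        eRow_contK n a t hn (m + 1) (by have := j.isLt; omega)
      have e2 : eRow n 0 ᵥ* aeval A (contK a t m) = eRow n m :=
        eRow_contK n a t hn m (by have := j.isLt; omega)
      simp only [hy]
      rw [grec, contK, mul_comm (X - C (a' (m + 1))) (g (m + 1)),
        mul_comm (X - C (a' (m + 1))) (contK a' t' (m + 1))]
      simp only [map_sub, map_add, map_mul, aeval_X, aeval_C, vecMul_sub, vecMul_add,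
        Algebra.algebraMap_eq_smul_one, vecMul_smul, smul_mul_assoc, one_mul, mul_sub,
        mul_smul_comm, mul_one, e1, e2, add_vecMul, vecMul_vecMul, smul_add, vecMul_one]
      abel
    rw [h1]
    simp
    ring

theorem core_poly (n : ℕ) (s s' t t' d β γ : ℕ → ℝ) (hd : StrictMono d)
    (ht : ∀ j, j + 1 < n → 0 < t j) (ht' : ∀ j, j + 1 < n → 0 < t' j)
    (hK : contK (fun j => (s' j : ℂ) + (d j : ℂ) * Complex.I) (fun j => (t' j : ℂ)) n =
      contK (fun j => (s j : ℂ) + (d j : ℂ) * Complex.I) (fun j => (t j : ℂ)) n)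
    (g : ℕ → Polynomial ℂ) (g0 : g 0 = 0) (g1 : g 1 = C (β 0 : ℂ))
    (grec : ∀ j, g (j + 2) = (X - C ((s' (j + 1) : ℂ) + (d (j + 1) : ℂ) * Complex.I)) * g (j + 1)
      - C (t' j : ℂ) * g j
      + C (β (j + 1) : ℂ) * contK (fun j => (s j : ℂ) + (d j : ℂ) * Complex.I) (fun j => (t j : ℂ)) (j + 1)
      + C (γ j : ℂ) * contK (fun j => (s j : ℂ) + (d j : ℂ) * Complex.I) (fun j => (t j : ℂ)) j)
    (gn : g n = 0) : (∀ j < n, β j = 0) ∧ (∀ j, j + 1 < n → γ j = 0) := by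
  obtain _ | N := n
  · simp
  set a : ℕ → ℂ := fun j => (s j : ℂ) + (d j : ℂ) * Complex.I with ha
  set a' : ℕ → ℂ := fun j => (s' j : ℂ) + (d j : ℂ) * Complex.I with ha'
  set A := triM (N + 1) a (fun j => (t j : ℂ)) with hA
  let M : (Fin (N + 1) → ℂ) → Matrix (Fin (N + 1)) (Fin (N + 1)) ℂ := fun v j =>
    v ᵥ* aeval A (contK a' (fun j => (t' j : ℂ)) j.val)
  let L : (Fin N → ℂ) →ₗ[ℂ] (Fin N → ℂ) :=
    { toFun := fun u j => M (Fin.cons 0 u) j.castSucc j.succ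
      map_add' := by
        intro u w
        ext j
        have : (Fin.cons 0 (u + w) : Fin (N + 1) → ℂ) = Fin.cons 0 u + Fin.cons 0 w := by
          ext i; refine Fin.cases ?_ (fun i => ?_) i <;> simp
        simp only [M, this, add_vecMul, Pi.add_apply]
      map_smul' := by
        intro c u
        ext j
        have : (Fin.cons 0 (c • u) : Fin (N + 1) → ℂ) = c • Fin.cons 0 u := by
          ext i; refine Fin.cases ?_ (fun i => ?_) i <;> simp
        simp only [M, this, smul_vecMul, Pi.smul_apply, RingHom.id_apply] }
  have hLinj : Function.Injective L := by
    rw [injective_iff_map_eq_zero]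
    intro u hu
    have hB := core_poly_mat (N + 1) (by omega) a a' (fun j => (t j : ℂ)) (fun j => (t' j : ℂ)) 0 0 hK
      (fun _ => 0) rfl (by simp) (by simp) rfl (Fin.cons 0 u) (M (Fin.cons 0 u)) (by
        intro j; simp [M, hA])
    have h0 := core_mat (N + 1) s s' t t' d hd ht ht' (M (Fin.cons 0 u)) _ hB (by simp) (by simp)
      (by
        intro j k hjk
        obtain ⟨j, hj⟩ := j
        obtain ⟨k, hk⟩ := k
        simp only at hjk
        subst hjk
        exact congrFun hu ⟨j, by omega⟩)
      (by
        intro j hj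
        have : j = 0 := Fin.ext hj
        subst this
        simp [M, contK])
    have h1 : M (Fin.cons 0 u) 0 = 0 := by rw [h0]; rfl
    simp only [M, Fin.val_zero, contK, map_one, vecMul_one] at h1
    ext i
    exact congrFun h1 i.succ
  have hLsurj := LinearMap.injective_iff_surjective.mp hLinj
  obtain ⟨u, hu⟩ := hLsurj (fun j => - (eRow (N + 1) 0 ᵥ* aeval A (g j.val)) j.succ)
  set Y : Matrix (Fin (N + 1)) (Fin (N + 1)) ℂ := fun j => eRow (N + 1) 0 ᵥ* aeval A (g j.val) +
      (Fin.cons 0 u : Fin (N + 1) → ℂ) ᵥ* aeval A (contK a' (fun j => (t' j : ℂ)) j.val) with hY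
  have hB := core_poly_mat (N + 1) (by omega) a a' (fun j => (t j : ℂ)) (fun j => (t' j : ℂ))
      (fun j => (β j : ℂ)) (fun j => (γ j : ℂ)) hK g g0 g1 grec gn (Fin.cons 0 u) Y (fun j => rfl)
  have hY0 := core_mat (N + 1) s s' t t' d hd ht ht' Y _ hB
    (by
      intro j k
      simp only [eRow]
      split_ifs <;> simp)
    (by
      intro j k h1 h2
      simp only [eRow]
      rw [if_neg (by omega)]
      split_ifs with h3 h4
      · simp
      · omega
      · simp)
    (by
      intro j k hjk
      obtain ⟨j, hj⟩ := j
      obtain ⟨k, hk⟩ := k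
      simp only at hjk
      subst hjk
      have := congrFun hu ⟨j, by omega⟩
      simp only [hY, Pi.add_apply]
      simp only [L, M, LinearMap.coe_mk, AddHom.coe_mk, Fin.castSucc_mk, Fin.succ_mk] at this
      rw [this]; ring)
    (by
      intro j hj
      have : j = 0 := Fin.ext hj
      subst this
      simp [hY, contK, g0])
  rw [hY0, Matrix.mul_zero, Matrix.zero_mul, sub_zero] at hB
  constructor
  · intro j hj
    have := congrFun (congrFun hB ⟨j, hj⟩) ⟨j, hj⟩
    simp only [eRow, Matrix.zero_apply, if_true] at this
    by_cases h0 : j = 0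
    · subst h0; simpa using this.symm
    · rw [if_neg h0, if_neg (by omega)] at this
      simpa using this.symm
  · intro j hj
    have := congrFun (congrFun hB ⟨j + 1, hj⟩) ⟨j, by omega⟩
    simpa [eRow] using this.symm


theorem exists_unitary_first (m : ℕ) (u : EuclideanSpace ℂ (Fin (m+1))) (hu : ‖u‖ = 1) :
    ∃ U : Matrix (Fin (m+1)) (Unit ⊕ Fin m) ℂ, Uᴴ * U = 1 ∧ U * Uᴴ = 1 ∧
      ∀ i, U i (Sum.inl ()) = u i := by
  have hv : Orthonormal ℂ (({Sum.inl ()} : Set (Unit ⊕ Fin m)).domRestrict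
      (fun _ => u)) := by
    rw [orthonormal_iff_ite]
    rintro ⟨i, hi⟩ ⟨j, hj⟩
    simp only [Set.mem_singleton_iff] at hi hj
    subst hi hj
    simp [hu]
  obtain ⟨b, hb⟩ := hv.exists_orthonormalBasis_extension_of_card_eq (by simp; ring)
  refine ⟨Matrix.of fun i j => b j i, ?_, ?_, ?_⟩
  · ext i j
    have := orthonormal_iff_ite.1 b.orthonormal i j
    simp only [PiLp.inner_apply, RCLike.inner_apply] at this
    simp only [Matrix.mul_apply, Matrix.conjTranspose_apply, Matrix.one_apply, ← this,
      Matrix.of_apply]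
    exact Finset.sum_congr rfl fun k _ => by rw [mul_comm]; rfl
  · ext i j
    have := b.sum_inner_mul_inner (EuclideanSpace.single i 1) (EuclideanSpace.single j 1)
    simp only [EuclideanSpace.inner_single_left, EuclideanSpace.inner_single_right] at this
    simp only [Matrix.mul_apply, Matrix.conjTranspose_apply, Matrix.one_apply]
    simp only [map_one, one_mul, PiLp.single_apply] at this
    simpa [eq_comm] using this
  · intro i
    rw [Matrix.of_apply, hb _ rfl]

theorem schur_sub (m : ℕ) : ∀ (M : Matrix (Fin m) (Fin m) ℂ) (T : Multiset ℂ),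
    T ≤ M.charpoly.roots → ∃ (κ : Type) (_ : Fintype κ) (_ : DecidableEq κ)
      (V : Matrix (Fin m) κ ℂ) (R : Matrix κ κ ℂ), Fintype.card κ = Multiset.card T ∧
      Vᴴ * V = 1 ∧ M * V = V * R ∧ trace R = T.sum := by
  induction m with
  | zero =>
    intro M T hT
    have : T = 0 := by
      have h : M.charpoly = 1 := by simp [Matrix.charpoly]
      rw [h] at hT; simpa using hT
    subst this
    exact ⟨Empty, inferInstance, inferInstance, 0, 0, by simp, by ext i; exact i.elim,
      by ext i j; exact j.elim, by simp⟩
  | succ m ih =>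
    intro M T hT
    induction T using Multiset.induction_on with
    | empty =>
      exact ⟨Empty, inferInstance, inferInstance, 0, 0, by simp, by ext i; exact i.elim,
        by ext i j; exact j.elim, by simp⟩
    | cons l T' _ =>
    have hl : l ∈ M.charpoly.roots := Multiset.mem_of_le hT (Multiset.mem_cons_self _ _)
    have hroot := (mem_roots'.1 hl).2
    have hdet : (Matrix.scalar _ l - M).det = 0 := by
      rw [IsRoot.def, Matrix.eval_charpoly] at hroot; exact hroot
    obtain ⟨v, hv0, hv⟩ := Matrix.exists_mulVec_eq_zero_iff.2 hdet
    have hMv : M *ᵥ v = l • v := by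
      rw [Matrix.sub_mulVec, sub_eq_zero] at hv
      rw [← hv]; simp [Matrix.scalar_apply, Matrix.diagonal_const_mulVec]
    set w : EuclideanSpace ℂ (Fin (m+1)) := WithLp.toLp 2 v with hw
    have hw0 : ‖w‖ ≠ 0 := by
      rw [norm_ne_zero_iff]; intro h; apply hv0
      ext i; exact congrArg (fun z : EuclideanSpace ℂ (Fin (m+1)) => z i) h
    obtain ⟨U, hU1, hU2, hU⟩ := exists_unitary_first m (((‖w‖ : ℂ)⁻¹) • w) (by
      rw [norm_smul, norm_inv, Complex.norm_real, norm_norm, inv_mul_cancel₀ hw0])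
    set N := Uᴴ * M * U with hN
    have hMU : M * U = U * N := by
      rw [hN, ← Matrix.mul_assoc, ← Matrix.mul_assoc, hU2, Matrix.one_mul]
    have hcol : ∀ i, N i (Sum.inl ()) = if i = Sum.inl () then l else 0 := by
      intro i
      have h1 : ∀ k, (M * U) k (Sum.inl ()) = l * U k (Sum.inl ()) := by
        intro k
        simp only [Matrix.mul_apply, hU]
        have := congrFun hMv k
        simp only [Matrix.mulVec, dotProduct, Pi.smul_apply, smul_eq_mul] at this
        simp only [PiLp.smul_apply, smul_eq_mul, hw]
        rw [← mul_left_comm, ← this, Finset.mul_sum]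
        exact Finset.sum_congr rfl fun x _ => by ring
      rw [hN, Matrix.mul_assoc, Matrix.mul_apply]
      simp only [h1]
      have h2 := congrFun (congrFun hU1 i) (Sum.inl ())
      rw [Matrix.mul_apply, Matrix.one_apply] at h2
      calc _ = l * ∑ x, Uᴴ i x * U x (Sum.inl ()) := by
            rw [Finset.mul_sum]; exact Finset.sum_congr rfl fun x _ => by ring
        _ = _ := by rw [h2]; simp
    have hchar : N.charpoly = M.charpoly := by
      have e : N.charpoly = (M * U * Uᴴ).charpoly := by
        rw [hN, Matrix.mul_assoc, Matrix.charpoly_mul_comm_of_le]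
        · simp [show 1 + m - (m + 1) = 0 by omega]
        · simp [add_comm]
      rw [e, Matrix.mul_assoc, hU2, Matrix.mul_one]
    have hblk : N = fromBlocks (diagonal fun _ => l) N.toBlocks₁₂ 0 N.toBlocks₂₂ := by
      ext i j
      rcases j with j | j
      · rw [hcol]; rcases i with i | i <;> simp
      · rcases i with i | i <;> simp [toBlocks₁₂, toBlocks₂₂]
    set r := N.toBlocks₁₂
    set M1 := N.toBlocks₂₂
    have hroots : M.charpoly.roots = l ::ₘ M1.charpoly.roots := by
      rw [← hchar, hblk, Matrix.charpoly_fromBlocks_zero₂₁, roots_mul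
        (mul_ne_zero (Matrix.charpoly_monic _).ne_zero (Matrix.charpoly_monic _).ne_zero),
        Matrix.charpoly_diagonal]
      simp
    rw [hroots, Multiset.cons_le_cons_iff] at hT
    obtain ⟨κ, _, _, V1, R1, hk, hV, hMV, hR⟩ := ih M1 T' hT
    obtain ⟨W, hW⟩ : ∃ W : Matrix (Unit ⊕ Fin m) (Unit ⊕ κ) ℂ, W = fromBlocks 1 0 0 V1 := ⟨_, rfl⟩
    obtain ⟨R, hRd⟩ : ∃ R : Matrix (Unit ⊕ κ) (Unit ⊕ κ) ℂ,
      R = fromBlocks (diagonal fun _ => l) (r * V1) 0 R1 := ⟨_, rfl⟩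
    refine ⟨Unit ⊕ κ, inferInstance, inferInstance, U * W, R, by simp [hk, add_comm], ?_, ?_, ?_⟩
    · rw [Matrix.conjTranspose_mul, Matrix.mul_assoc, ← Matrix.mul_assoc Uᴴ, hU1, Matrix.one_mul, hW,
        fromBlocks_conjTranspose, fromBlocks_multiply]
      simp [hV]
    · have hNW : N * W = W * R := by
        rw [hblk, hW, hRd, fromBlocks_multiply, fromBlocks_multiply]
        simp [hMV]
      rw [← Matrix.mul_assoc, hMU, Matrix.mul_assoc, hNW, Matrix.mul_assoc]
    · rw [hRd, Multiset.sum_cons, ← hR]; simp [trace]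

theorem det_tri {R : Type*} [CommRing R] (n : ℕ) (e : ℕ → ℕ → R)
    (h1 : ∀ j, e 0 (j + 2) = 0) (h2 : ∀ j, e (j + 2) 0 = 0) :
    (Matrix.of fun i j : Fin (n + 2) => e i j).det =
      e 0 0 * (Matrix.of fun i j : Fin (n + 1) => e (i + 1) (j + 1)).det -
      e 0 1 * e 1 0 * (Matrix.of fun i j : Fin n => e (i + 2) (j + 2)).det := by
  rw [Matrix.det_succ_row_zero, Fin.sum_univ_succ, Fin.sum_univ_succ]
  have hz : ∀ i : Fin n, (Matrix.of fun i j : Fin (n + 2) => e i j) 0 i.succ.succ = 0 := by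
    intro i; simpa using h1 i
  simp only [hz]
  have hd : ((Matrix.of fun i j : Fin (n + 2) => e i j).submatrix Fin.succ
      (Fin.succAbove (Fin.succ 0))).det =
      e 1 0 * (Matrix.of fun i j : Fin n => e (i + 2) (j + 2)).det := by
    rw [Matrix.det_succ_column_zero, Fin.sum_univ_succ]
    have hz2 : ∀ i : Fin n, ((Matrix.of fun i j : Fin (n + 2) => e i j).submatrix Fin.succ
      (Fin.succAbove (Fin.succ 0))) i.succ 0 = 0 := by
      intro i; simpa using h2 i
    simp only [hz2]
    simp
    congr 2
  rw [hd]
  have hd0 : ((Matrix.of fun i j : Fin (n + 2) => e i j).submatrix Fin.succ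
      (Fin.succAbove 0)).det = (Matrix.of fun i j : Fin (n + 1) => e (i + 1) (j + 1)).det := by
    congr 1
  rw [hd0]
  simp
  ring

/-- Symmetric tridiagonal matrix. -/
noncomputable def symE (a r : ℕ → ℂ) (i j : ℕ) : ℂ :=
  if i = j then a i else if i + 1 = j then r i else if j + 1 = i then r j else 0

noncomputable def symM (n : ℕ) (a r : ℕ → ℂ) : Matrix (Fin n) (Fin n) ℂ :=
  Matrix.of fun i j => symE a r i j

theorem symM_charpoly_aux (n : ℕ) : ∀ (a r : ℕ → ℂ),
    (symM n a r).charpoly = contK a (fun j => r j ^ 2) n ∧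
    (symM (n + 1) a r).charpoly = contK a (fun j => r j ^ 2) (n + 1) := by
  induction n with
  | zero =>
    intro a r
    refine ⟨by simp [Matrix.charpoly, contK], ?_⟩
    simp [Matrix.charpoly, contK, symM, symE, Matrix.charmatrix]
  | succ n ih =>
    intro a r
    refine ⟨(ih a r).2, ?_⟩
    have key : ∀ (m : ℕ) (a r : ℕ → ℂ), (symM m a r).charmatrix =
        Matrix.of fun i j : Fin m => (fun i j : ℕ => (if i = j then X else 0) - C (symE a r i j)) i j := by
      intro m a r
      ext1 i j
      simp [Matrix.charmatrix_apply, symM, Matrix.diagonal_apply, Fin.ext_iff]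
    have h1 := (ih (fun j => a (j + 1)) (fun j => r (j + 1))).2
    have h2 := (ih (fun j => a (j + 1 + 1)) (fun j => r (j + 1 + 1))).1
    have hf := contK_front_aux n a (fun j => r j ^ 2)
    rw [Matrix.charpoly, key] at h1 h2 ⊢
    have hdt := det_tri n (fun i j : ℕ => (if i = j then (X : ℂ[X]) else 0) - C (symE a r i j))
      (by intro j; simp [symE]) (by intro j; simp [symE])
    refine hdt.trans ?_
    have e1 : (Matrix.of fun i j : Fin (n + 1) => (if i.val + 1 = j.val + 1 then (X : ℂ[X]) else 0)
        - C (symE a r (i + 1) (j + 1))).det = contK (fun j => a (j + 1)) (fun j => r (j + 1) ^ 2) (n + 1) := by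
      rw [← h1]; congr 1; ext1 i j; simp [symE]
    have e2 : (Matrix.of fun i j : Fin n => (if i.val + 2 = j.val + 2 then (X : ℂ[X]) else 0)
        - C (symE a r (i + 2) (j + 2))).det = contK (fun j => a (j + 2)) (fun j => r (j + 2) ^ 2) n := by
      rw [← h2]; congr 1; ext1 i j
      simp [symE]
    rw [e1, e2, hf]
    simp [symE]
    left
    ring

theorem symM_charpoly (n : ℕ) (a r : ℕ → ℂ) :
    (symM n a r).charpoly = contK a (fun j => r j ^ 2) n := (symM_charpoly_aux n a r).1


theorem map_im_sum (T : Multiset ℂ) : (T.map Complex.im).sum = T.sum.im :=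
  (map_multiset_sum Complex.imAddGroupHom T).symm

theorem weight_ineq (n k : ℕ) (hk : k ≤ n) (c d : ℕ → ℝ) (hd : StrictMono d)
    (h0 : ∀ j < n, 0 ≤ c j) (h1 : ∀ j < n, c j ≤ 1)
    (hs : ∑ j ∈ Finset.range n, c j = k) :
    ∑ j ∈ Finset.range k, d j ≤ ∑ j ∈ Finset.range n, d j * c j ∧
    (∑ j ∈ Finset.range k, d j = ∑ j ∈ Finset.range n, d j * c j →
      (∀ j < n, j < k → c j = 1) ∧ (∀ j < n, k ≤ j → c j = 0)) := by
  have hI : ∀ f : ℕ → ℝ, ∑ j ∈ Finset.range k, f j =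
      ∑ j ∈ Finset.range n, if j < k then f j else 0 := by
    intro f
    rw [← Finset.sum_filter]
    congr 1
    ext j; simp; omega
  have hkk : (k : ℝ) = ∑ j ∈ Finset.range n, if j < k then (1 : ℝ) else 0 := by
    rw [← hI]; simp
  have key : ∑ j ∈ Finset.range n, d j * c j - ∑ j ∈ Finset.range k, d j =
      ∑ j ∈ Finset.range n, (d j - d k) * (c j - if j < k then 1 else 0) := by
    have : ∀ j, (d j - d k) * (c j - if j < k then 1 else 0) =
        d j * c j - (if j < k then d j else 0) - d k * (c j - if j < k then 1 else 0) := by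
      intro j; split_ifs <;> ring
    simp only [this]
    rw [Finset.sum_sub_distrib, Finset.sum_sub_distrib, ← Finset.mul_sum, Finset.sum_sub_distrib,
      hs, ← hkk, ← hI]
    ring
  have hnn : ∀ j ∈ Finset.range n, 0 ≤ (d j - d k) * (c j - if j < k then 1 else 0) := by
    intro j hj
    rw [Finset.mem_range] at hj
    split_ifs with h
    · have := hd h
      have := h1 j hj
      nlinarith
    · have := hd.monotone (not_lt.1 h)
      have := h0 j hj
      nlinarith
  refine ⟨by rw [← sub_nonneg, key]; exact Finset.sum_nonneg hnn, ?_⟩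
  intro he
  have hz := (Finset.sum_eq_zero_iff_of_nonneg hnn).1 (by rw [← key]; linarith)
  have hA : ∀ j < n, j < k → c j = 1 := by
    intro j hj hjk
    have := hz j (Finset.mem_range.2 hj)
    rw [if_pos hjk] at this
    have h3 := hd hjk
    rcases mul_eq_zero.1 this with h | h <;> linarith
  refine ⟨hA, ?_⟩
  have hz2 : ∀ j ∈ Finset.range n, 0 ≤ c j - if j < k then 1 else 0 := by
    intro j hj
    rw [Finset.mem_range] at hj
    split_ifs with h
    · rw [hA j hj h]; simp
    · simpa using h0 j hj
  have hz3 := (Finset.sum_eq_zero_iff_of_nonneg hz2).1 (by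
    rw [Finset.sum_sub_distrib, hs, ← hkk]; ring)
  intro j hj hkj
  have := hz3 j (Finset.mem_range.2 hj)
  rwa [if_neg (by omega), sub_zero] at this

theorem kyFan (n : ℕ) (s t d : ℕ → ℝ) (hd : StrictMono d) (ht : ∀ j, j + 1 < n → 0 ≤ t j)
    (T : Multiset ℂ)
    (hT : T ≤ (contK (fun j => (s j : ℂ) + (d j : ℂ) * Complex.I) (fun j => (t j : ℂ)) n).roots) :
    ∑ j ∈ Finset.range (Multiset.card T), d j ≤ (T.map Complex.im).sum ∧
    ∀ k, k + 1 < n → Multiset.card T = k + 1 →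
      ∑ j ∈ Finset.range (Multiset.card T), d j = (T.map Complex.im).sum → t k = 0 := by
  set a : ℕ → ℂ := fun j => (s j : ℂ) + (d j : ℂ) * Complex.I with ha
  set r : ℕ → ℂ := fun j => ((√(t j) : ℝ) : ℂ) with hr
  have hcard : Multiset.card T ≤ n := by
    refine (Multiset.card_le_card hT).trans ((card_roots' _).trans ?_)
    rw [contK_natDegree]
  have hKr : contK a (fun j => (t j : ℂ)) n = (symM n a r).charpoly := by
    rw [symM_charpoly]
    apply contK_congr
    · intros; rfl
    · intro j hj
      simp only [hr]
      rw [← Complex.ofReal_pow, Real.sq_sqrt (ht j hj)]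
  rw [hKr] at hT
  obtain ⟨κ, _, _, V, R, hκ, hV, hMV, hR⟩ := schur_sub n _ T hT
  set P := V * Vᴴ with hP
  have hPh : P.IsHermitian := Matrix.isHermitian_mul_conjTranspose_self V
  have hPP : P * P = P := by
    rw [hP, Matrix.mul_assoc, ← Matrix.mul_assoc Vᴴ, hV, Matrix.one_mul]
  have htr : T.sum = trace (symM n a r * P) := by
    rw [hP, ← Matrix.mul_assoc, hMV, Matrix.mul_assoc, Matrix.trace_mul_comm, Matrix.mul_assoc, hV,
      Matrix.mul_one, hR]
  have hdec : symM n a r = symM n (fun j => (s j : ℂ)) r +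
      Matrix.diagonal (fun j : Fin n => (d j : ℂ) * Complex.I) := by
    ext i j
    simp only [symM, symE, Matrix.add_apply, Matrix.of_apply, Matrix.diagonal_apply, ha, Fin.ext_iff]
    split_ifs <;> simp
  have hXh : (symM n (fun j => (s j : ℂ)) r).IsHermitian := by
    ext i j
    simp only [symM, symE, Matrix.conjTranspose_apply, Matrix.of_apply]
    split_ifs <;> first | omega | simp_all
  have him : (T.map Complex.im).sum = ∑ j : Fin n, d j * (P j j).re := by
    rw [map_im_sum, htr, hdec, Matrix.add_mul, Matrix.trace_add, Complex.add_im,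
      trace_mul_herm_im _ _ hXh hPh, zero_add]
    simp [Matrix.trace, Matrix.diagonal_mul]
  have hPc : ∀ j, (P j j).re = ∑ i, Complex.normSq (V j i) := by
    intro j
    rw [hP, Matrix.mul_apply, Complex.re_sum]
    refine Finset.sum_congr rfl fun i _ => ?_
    rw [Matrix.conjTranspose_apply, Complex.star_def, Complex.mul_conj, Complex.ofReal_re]
  have hc0 : ∀ j, 0 ≤ (P j j).re := by
    intro j; rw [hPc]; exact Finset.sum_nonneg fun i _ => Complex.normSq_nonneg _
  have hc1 : ∀ j, (P j j).re ≤ 1 := by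
    intro j
    have h : (P j j).re = ∑ k, Complex.normSq (P j k) := by
      conv_lhs => rw [← hPP]
      rw [Matrix.mul_apply, Complex.re_sum]
      refine Finset.sum_congr rfl fun i _ => ?_
      rw [← hPh.apply i j, Complex.star_def, Complex.mul_conj, Complex.ofReal_re]
    have h2 : Complex.normSq (P j j) ≤ ∑ k, Complex.normSq (P j k) :=
      Finset.single_le_sum (f := fun k => Complex.normSq (P j k))
        (fun i _ => Complex.normSq_nonneg _) (Finset.mem_univ j)
    rw [← h, Complex.normSq_apply] at h2
    nlinarith [hc0 j, mul_self_nonneg (P j j).im]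
  have hcs : ∑ j : Fin n, (P j j).re = Multiset.card T := by
    have : trace P = (Multiset.card T : ℂ) := by
      rw [hP, Matrix.trace_mul_comm, hV, Matrix.trace_one, hκ]
    have h := congrArg Complex.re this
    simpa [Matrix.trace] using h
  set c : ℕ → ℝ := fun j => if h : j < n then (P ⟨j, h⟩ ⟨j, h⟩).re else 0 with hc
  have hcj : ∀ j : Fin n, c j = (P j j).re := by intro j; simp [hc]
  obtain ⟨w1, w2⟩ := weight_ineq n (Multiset.card T) hcard c d hd
    (by intro j hj; simpa [hc, hj] using hc0 ⟨j, hj⟩)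
    (by intro j hj; simpa [hc, hj] using hc1 ⟨j, hj⟩)
    (by rw [Finset.sum_range, ← hcs]; exact Finset.sum_congr rfl fun j _ => hcj j)
  have hsum : ∑ j ∈ Finset.range n, d j * c j = (T.map Complex.im).sum := by
    rw [him, Finset.sum_range]; exact Finset.sum_congr rfl fun j _ => by rw [hcj]
  rw [hsum] at w1 w2
  refine ⟨w1, ?_⟩
  intro k hk hTk he
  obtain ⟨wa, wb⟩ := w2 he
  rw [hTk] at wa wb
  have hVz : ∀ j : Fin n, k + 1 ≤ j.val → ∀ i, V j i = 0 := by
    intro j hj i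
    have h := wb j j.2 hj
    rw [hcj, hPc] at h
    have := (Finset.sum_eq_zero_iff_of_nonneg (fun i _ => Complex.normSq_nonneg _)).1 h i
      (Finset.mem_univ i)
    exact Complex.normSq_eq_zero.1 this
  have hk1 := wa k (by omega) (by omega)
  rw [show c k = (P ⟨k, by omega⟩ ⟨k, by omega⟩).re from hcj ⟨k, by omega⟩, hPc] at hk1
  have hrow : ∀ i, r k * V ⟨k, by omega⟩ i = 0 := by
    intro i
    have h := congrFun (congrFun hMV ⟨k + 1, hk⟩) i
    rw [Matrix.mul_apply, Matrix.mul_apply] at h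
    rw [Finset.sum_eq_single (⟨k, by omega⟩ : Fin n)] at h
    · rw [Finset.sum_eq_zero] at h
      · simpa [symM, symE, show k + 1 + 1 ≠ k by omega] using h
      · intro x _; rw [hVz _ (by simp), zero_mul]
    · intro b _ hb
      by_cases hbk : k + 1 ≤ b.val
      · rw [hVz b hbk, mul_zero]
      · have : b.val ≠ k := fun h => hb (Fin.ext h)
        have e : symM n a r ⟨k + 1, hk⟩ b = 0 := by
          simp only [symM, symE, Matrix.of_apply]
          rw [if_neg (by omega), if_neg (by omega), if_neg (by omega)]
        rw [e, zero_mul]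
    · simp
  have hrk : r k = 0 := by
    by_contra hne
    have : ∑ i, Complex.normSq (V ⟨k, by omega⟩ i) = 0 := Finset.sum_eq_zero fun i _ => by
      rw [(mul_eq_zero.1 (hrow i)).resolve_left hne]; simp
    rw [this] at hk1; simp at hk1
  simp only [hr, Complex.ofReal_eq_zero] at hrk
  exact le_antisymm (Real.sqrt_eq_zero'.1 hrk) (ht k hk)


noncomputable def aS (s d : ℕ → ℝ) : ℕ → ℂ := fun j => (s j : ℂ) + (d j : ℂ) * Complex.I
noncomputable def tS (t : ℕ → ℝ) : ℕ → ℂ := fun j => (t j : ℂ)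

theorem contK_roots_card (a t : ℕ → ℂ) (m : ℕ) : Multiset.card (contK a t m).roots = m := by
  rw [← (IsAlgClosed.splits _).natDegree_eq_card_roots, contK_natDegree]

theorem contK_eq_of_roots (a t a' t' : ℕ → ℂ) (m m' : ℕ)
    (h : (contK a t m).roots = (contK a' t' m').roots) : contK a t m = contK a' t' m' := by
  rw [(IsAlgClosed.splits (contK a t m)).eq_prod_roots_of_monic (contK_monic _ _ _), h,
    ← (IsAlgClosed.splits (contK a' t' m')).eq_prod_roots_of_monic (contK_monic _ _ _)]

theorem contK_roots_im (s d t : ℕ → ℝ) (m : ℕ) :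
    ((contK (aS s d) (tS t) m).roots.map Complex.im).sum = ∑ j ∈ Finset.range m, d j := by
  rw [map_im_sum]
  rcases m with _ | m
  · simp [contK]
  · have h := (IsAlgClosed.splits (contK (aS s d) (tS t) (m+1))).nextCoeff_eq_neg_sum_roots_of_monic
      (contK_monic _ _ _)
    rw [nextCoeff_of_natDegree_pos (by rw [contK_natDegree]; omega), contK_natDegree] at h
    simp only [Nat.add_sub_cancel] at h
    rw [contK_coeff_one, neg_inj] at h
    rw [← h]
    simp [aS, Complex.im_sum]

theorem tight_of_zero (s d t : ℕ → ℝ) (k m : ℕ) (hk : t k = 0) :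
    (contK (aS s d) (tS t) (k + 1)).roots ≤ (contK (aS s d) (tS t) (k + 1 + m)).roots := by
  rw [contK_split _ _ k (by simp [tS, hk]), roots_mul]
  · exact Multiset.le_add_right _ _
  · exact mul_ne_zero (contK_monic _ _ _).ne_zero (contK_monic _ _ _).ne_zero

theorem f_convex (d : ℕ → ℝ) (hd : StrictMono d) (p m : ℕ) (hm : 0 < m) :
    2 * ∑ j ∈ Finset.range (p + m), d j <
      ∑ j ∈ Finset.range (p + m + m), d j + ∑ j ∈ Finset.range p, d j := by
  rw [Finset.sum_range_add d (p + m) m, Finset.sum_range_add d p m]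
  have : ∑ x ∈ Finset.range m, d (p + x) < ∑ x ∈ Finset.range m, d (p + m + x) := by
    apply Finset.sum_lt_sum_of_nonempty (by simpa using hm.ne')
    intro i _
    exact hd (by omega)
  linarith

theorem tight_unique (d : ℕ → ℝ) (hd : StrictMono d) (Z T T' : Multiset ℂ)
    (hZ : ∀ T ≤ Z, ∑ j ∈ Finset.range (Multiset.card T), d j ≤ (T.map Complex.im).sum)
    (hT : T ≤ Z) (hT' : T' ≤ Z) (hc : Multiset.card T = Multiset.card T')
    (h : (T.map Complex.im).sum = ∑ j ∈ Finset.range (Multiset.card T), d j)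
    (h' : (T'.map Complex.im).sum = ∑ j ∈ Finset.range (Multiset.card T'), d j) : T = T' := by
  by_contra hne
  have hI := hZ (T ∩ T') ((Multiset.inter_le_left).trans hT)
  have hU := hZ (T ∪ T') (Multiset.union_le hT hT')
  have hadd : T ∪ T' + T ∩ T' = T + T' := Multiset.union_add_inter T T'
  have hcard := congrArg Multiset.card hadd
  have hsum := congrArg (fun Z => (Multiset.map Complex.im Z).sum) hadd
  simp only [Multiset.card_add, Multiset.map_add, Multiset.sum_add] at hcard hsum
  have hlt : Multiset.card (T ∩ T') < Multiset.card T := by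
    refine Multiset.card_lt_card (lt_of_le_of_ne Multiset.inter_le_left ?_)
    intro he
    have : T ≤ T' := by rw [← he]; exact Multiset.inter_le_right
    exact hne (Multiset.eq_of_le_of_card_le this hc.ge)
  obtain ⟨m, hm⟩ := Nat.exists_eq_add_of_lt hlt
  have e1 : Multiset.card T = Multiset.card (T ∩ T') + (m + 1) := by omega
  have e2 : Multiset.card (T ∪ T') = Multiset.card (T ∩ T') + (m + 1) + (m + 1) := by omega
  have := f_convex d hd (Multiset.card (T ∩ T')) (m + 1) (by omega)
  rw [h, h', ← hc] at hsum
  rw [e2] at hU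
  rw [e1] at hsum
  linarith

theorem contK_inj (n : ℕ) : ∀ (d s s' t t' : ℕ → ℝ), StrictMono d →
    (∀ j, j + 1 < n → 0 ≤ t j) → (∀ j, j + 1 < n → 0 ≤ t' j) →
    contK (aS s d) (tS t) n = contK (aS s' d) (tS t') n →
    (∀ j < n, s j = s' j) ∧ (∀ j, j + 1 < n → t j = t' j) := by
  induction n using Nat.strong_induction_on with
  | _ n ih =>
  intro d s s' t t' hd ht ht' hK
  have hz : ∀ k, k + 1 < n → (t k = 0 ∨ t' k = 0) → t k = 0 ∧ t' k = 0 := by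
    intro k hk h
    obtain ⟨m, rfl⟩ := Nat.exists_eq_add_of_lt hk
    rcases h with h | h
    · refine ⟨h, ?_⟩
      have h1 := tight_of_zero s d t k (m + 1) h
      rw [show k + 1 + (m + 1) = k + 1 + m + 1 by ring, hK] at h1
      refine (kyFan _ s' t' d hd ht' _ h1).2 k hk (contK_roots_card _ _ _) ?_
      rw [contK_roots_im, contK_roots_card]
    · refine ⟨?_, h⟩
      have h1 := tight_of_zero s' d t' k (m + 1) h
      rw [show k + 1 + (m + 1) = k + 1 + m + 1 by ring, ← hK] at h1
      refine (kyFan _ s t d hd ht _ h1).2 k hk (contK_roots_card _ _ _) ?_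
      rw [contK_roots_im, contK_roots_card]
  by_cases hex : ∃ k, k + 1 < n ∧ t k = 0
  · obtain ⟨k, hk, htk⟩ := hex
    have htk' := (hz k hk (Or.inl htk)).2
    obtain ⟨m, rfl⟩ := Nat.exists_eq_add_of_lt hk
    rw [show k + 1 + m + 1 = k + 1 + (m + 1) by ring] at *
    have h1 := tight_of_zero s d t k (m + 1) htk
    have h2 := tight_of_zero s' d t' k (m + 1) htk'
    rw [← hK] at h2
    have hTT := tight_unique d hd _ _ _ (fun T hT => (kyFan _ s t d hd ht T hT).1) h1 h2
      (by rw [contK_roots_card, contK_roots_card]) (by rw [contK_roots_im, contK_roots_card])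
      (by rw [contK_roots_im, contK_roots_card])
    have hK1 := contK_eq_of_roots _ _ _ _ _ _ hTT
    have hK2 := hK
    rw [contK_split _ _ k (by simp [tS, htk]), contK_split _ _ k (by simp [tS, htk']), hK1] at hK2
    have hK3 := mul_left_cancel₀ (contK_monic _ _ _).ne_zero hK2
    obtain ⟨p1, p2⟩ := ih (k + 1) hk d s s' t t' hd (fun j hj => ht j (by omega))
      (fun j hj => ht' j (by omega)) hK1
    obtain ⟨q1, q2⟩ := ih (m + 1) (by omega) (fun j => d (k + 1 + j)) (fun j => s (k + 1 + j))
      (fun j => s' (k + 1 + j)) (fun j => t (k + 1 + j)) (fun j => t' (k + 1 + j))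
      (fun i j hij => hd (by omega)) (fun j hj => ht _ (by omega))
      (fun j hj => ht' _ (by omega)) hK3
    constructor
    · intro j hj
      by_cases hjk : j < k + 1
      · exact p1 j hjk
      · obtain ⟨i, rfl⟩ := Nat.exists_eq_add_of_le (not_lt.1 hjk)
        exact q1 i (by omega)
    · intro j hj
      rcases lt_trichotomy j k with hjk | hjk | hjk
      · exact p2 j (by omega)
      · rw [hjk, htk, htk']
      · obtain ⟨i, rfl⟩ := Nat.exists_eq_add_of_le (show k + 1 ≤ j from hjk)
        exact q2 i (by omega)
  · push Not at hex
    have hpos : ∀ j, j + 1 < n → 0 < t j := fun j hj => lt_of_le_of_ne (ht j hj) (hex j hj).symm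
    have hpos' : ∀ j, j + 1 < n → 0 < t' j := fun j hj => lt_of_le_of_ne (ht' j hj)
      (fun h => hex j hj (hz j hj (Or.inr h.symm)).1)
    obtain ⟨b1, b2⟩ := core_poly n s s' t t' d (fun j => s' j - s j) (fun j => t' j - t j) hd hpos
      hpos' hK.symm (fun j => contK (aS s d) (tS t) j - contK (aS s' d) (tS t') j)
      (by simp [contK]) (by simp only [contK, aS]; push_cast; simp only [map_add, map_sub]; ring)
      (by
        intro j
        change _ = _ + C _ * contK (aS s d) (tS t) (j + 1) + C _ * contK (aS s d) (tS t) j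
        simp only [contK]
        simp only [aS, tS]
        push_cast; simp only [map_add, map_sub]; ring)
      (by rw [hK]; simp)
    exact ⟨fun j hj => by have := b1 j hj; linarith, fun j hj => by have := b2 j hj; linarith⟩


abbrev EE (n : ℕ) := (Fin n → ℝ) × (Fin (n - 1) → ℝ)

theorem gridPoly_coeff (n : ℕ) (a : Fin n → ℝ) (b : Fin (n - 1) → ℝ) (k : Fin n) :
    (gridPoly n a b).coeff (n - (k.val + 1)) =
      (-1 : ℂ) ^ (k.val + 1) * ((a k : ℂ) + (bExt n b k : ℂ) * Complex.I) := by
  unfold gridPoly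
  rw [coeff_add, coeff_X_pow, if_neg (by have := k.2; omega), zero_add, finsetSum_coeff,
    Finset.sum_eq_single k]
  · rw [coeff_C_mul_X_pow, if_pos rfl]
  · intro j _ hj
    rw [coeff_C_mul_X_pow, if_neg]
    intro h
    exact hj (Fin.ext (by have := k.2; have := j.2; omega))
  · simp

theorem gridPoly_monic_deg (n : ℕ) (a : Fin n → ℝ) (b : Fin (n - 1) → ℝ) :
    (gridPoly n a b).Monic ∧ (gridPoly n a b).natDegree = n := by
  have hdeg : (∑ k : Fin n,
      Polynomial.C ((-1 : ℂ) ^ (k.val + 1) * ((a k : ℂ) + (bExt n b k : ℂ) * Complex.I)) *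
        Polynomial.X ^ (n - (k.val + 1))).degree < (n : WithBot ℕ) := by
    refine lt_of_le_of_lt (degree_sum_le _ _) ?_
    refine (Finset.sup_lt_iff (WithBot.bot_lt_coe n)).2 ?_
    intro k _
    refine lt_of_le_of_lt (degree_C_mul_X_pow_le _ _) ?_
    have h : n - (k.val + 1) < n := by have := k.2; omega
    exact WithBot.coe_lt_coe.2 h
  constructor
  · exact monic_X_pow_add hdeg
  · unfold gridPoly
    rw [natDegree_add_eq_left_of_degree_lt]
    · simp
    · simpa using hdeg

noncomputable def cmap (n : ℕ) (P : ℂ[X]) : EE n :=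
  (fun k => ((-1 : ℂ) ^ (k.val + 1) * P.coeff (n - (k.val + 1))).re,
   fun k => ((-1 : ℂ) ^ (k.val + 1 + 1) * P.coeff (n - (k.val + 1 + 1))).im)

theorem neg_one_sq_aux (m : ℕ) (z : ℂ) : (-1 : ℂ) ^ m * ((-1) ^ m * z) = z := by
  rw [← mul_assoc, ← mul_pow]; simp

theorem cmap_gridPoly (n : ℕ) (q : EE n) : cmap n (gridPoly n q.1 q.2) = q := by
  ext k
  · simp only [cmap]
    rw [gridPoly_coeff, neg_one_sq_aux]
    simp
  · simp only [cmap]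
    have := gridPoly_coeff n q.1 q.2 ⟨k.val + 1, by have := k.2; omega⟩
    simp only at this
    rw [this, neg_one_sq_aux]
    simp [bExt]

theorem gridPoly_cmap (n : ℕ) (P : ℂ[X]) (hm : P.Monic) (hd : P.natDegree = n)
    (h1 : (P.coeff (n - 1)).im = - ((n * (n + 1) : ℝ) / 2)) :
    gridPoly n (cmap n P).1 (cmap n P).2 = P := by
  have hc : ∀ k : Fin n, (gridPoly n (cmap n P).1 (cmap n P).2).coeff (n - (k.val + 1)) =
      P.coeff (n - (k.val + 1)) := by
    intro k
    rw [gridPoly_coeff]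
    have : (((cmap n P).1 k : ℂ) + (bExt n (cmap n P).2 k : ℂ) * Complex.I) =
      (-1 : ℂ) ^ (k.val + 1) * P.coeff (n - (k.val + 1)) := by
      apply Complex.ext
      · simp [cmap]
      · simp only [bExt, cmap]
        by_cases hk : k.val = 0
        · simp [hk, h1]
        · have e : k.val - 1 + 1 = k.val := by omega
          simp [hk, e]
    rw [this, neg_one_sq_aux]
  obtain ⟨gm, gd⟩ := gridPoly_monic_deg n (cmap n P).1 (cmap n P).2
  ext i
  rcases lt_trichotomy i n with h | h | h
  · have := hc ⟨n - 1 - i, by omega⟩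
    simp only at this
    rwa [show n - (n - 1 - i + 1) = i by omega] at this
  · rw [h]
    have e1 := hm.coeff_natDegree
    have e2 := gm.coeff_natDegree
    rw [hd] at e1
    rw [gd] at e2
    rw [e1, e2]
  · rw [coeff_eq_zero_of_natDegree_lt (by omega), coeff_eq_zero_of_natDegree_lt (by omega)]

def sE {n : ℕ} (p : EE n) : ℕ → ℝ := fun j => if h : j < n then p.1 ⟨j, h⟩ else 0
def tE {n : ℕ} (p : EE n) : ℕ → ℝ := fun j => if h : j < n - 1 then p.2 ⟨j, h⟩ else 0
def dN : ℕ → ℝ := fun j => (j : ℝ) + 1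

theorem dN_mono : StrictMono dN := by
  intro i j h; simp only [dN]; have : (i : ℝ) < j := by exact_mod_cast h
  linarith

theorem dN_sum (k : ℕ) : ∑ j ∈ Finset.range k, dN j = (k * (k + 1) : ℝ) / 2 := by
  induction k with
  | zero => simp
  | succ k ih => rw [Finset.sum_range_succ, ih]; simp only [dN]; push_cast; ring

noncomputable def KK {n : ℕ} (p : EE n) (m : ℕ) : ℂ[X] := contK (aS (sE p) dN) (tS (tE p)) m

noncomputable def PsiN (n : ℕ) (p : EE n) : EE n := cmap n (KK p n)

theorem gridPoly_Psi (n : ℕ) (hn : 1 ≤ n) (p : EE n) :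
    gridPoly n (PsiN n p).1 (PsiN n p).2 = KK p n := by
  apply gridPoly_cmap
  · exact contK_monic _ _ _
  · exact contK_natDegree _ _ _
  · obtain ⟨m, rfl⟩ := Nat.exists_eq_add_of_le' hn
    rw [Nat.add_sub_cancel, KK, contK_coeff_one, ← dN_sum]
    simp [aS, Complex.im_sum]

theorem KK_coeff_contDiff (n : ℕ) (m : ℕ) : ∀ i, ContDiff ℝ (⊤ : ℕ∞)
    (fun p : EE n => (KK p m).coeff i) := by
  have hs : ∀ j, ContDiff ℝ (⊤ : ℕ∞) (fun p : EE n => aS (sE p) dN j) := by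
    intro j
    have : ContDiff ℝ (⊤ : ℕ∞) (fun p : EE n => sE p j) := by
      by_cases h : j < n
      · simp only [sE, dif_pos h]; fun_prop
      · simp only [sE, dif_neg h]; fun_prop
    exact ContDiff.add (Complex.ofRealCLM.contDiff.comp this) contDiff_const
  have ht : ∀ j, ContDiff ℝ (⊤ : ℕ∞) (fun p : EE n => tS (tE p) j) := by
    intro j
    have : ContDiff ℝ (⊤ : ℕ∞) (fun p : EE n => tE p j) := by
      by_cases h : j < n - 1
      · simp only [tE, dif_pos h]; fun_prop
      · simp only [tE, dif_neg h]; fun_prop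
    exact (Complex.ofRealCLM.contDiff.comp this)
  unfold KK
  induction m using Nat.twoStepInduction with
  | zero => intro i; simp only [contK]; exact contDiff_const
  | one =>
    intro i
    simp only [contK, coeff_sub, coeff_C]
    refine contDiff_const.sub ?_
    split_ifs
    · exact hs 0
    · exact contDiff_const
  | more m h1 h2 =>
    intro i
    simp only [contK, sub_mul, coeff_sub, coeff_C_mul]
    refine ContDiff.sub (ContDiff.sub ?_ ((hs _).mul (h2 i))) ((ht _).mul (h1 i))
    rcases i with _ | i
    · simp only [coeff_X_mul_zero]; exact contDiff_const
    · simp only [coeff_X_mul]; exact h2 i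

theorem Psi_contDiff (n : ℕ) : ContDiff ℝ (⊤ : ℕ∞) (PsiN n) := by
  unfold PsiN cmap
  refine ContDiff.prodMk ?_ ?_
  · rw [contDiff_pi]
    intro k
    exact Complex.reCLM.contDiff.comp (contDiff_const.mul (KK_coeff_contDiff n n _))
  · rw [contDiff_pi]
    intro k
    exact Complex.imCLM.contDiff.comp (contDiff_const.mul (KK_coeff_contDiff n n _))

theorem ext_inj {n : ℕ} (p q : EE n) (h1 : ∀ j < n, sE p j = sE q j)
    (h2 : ∀ j, j + 1 < n → tE p j = tE q j) : p = q := by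
  ext k
  · simpa [sE] using h1 k k.2
  · have := h2 k (by have := k.2; omega)
    simpa [tE] using this

theorem tE_nonneg {n : ℕ} (p : EE n) (hp : ∀ k, 0 ≤ p.2 k) (j : ℕ) : 0 ≤ tE p j := by
  unfold tE; split_ifs; exacts [hp _, le_rfl]

theorem tE_pos {n : ℕ} (p : EE n) (hp : ∀ k, 0 < p.2 k) (j : ℕ) (hj : j + 1 < n) : 0 < tE p j := by
  unfold tE; rw [dif_pos (by omega)]; exact hp _

theorem Psi_inj (n : ℕ) (hn : 1 ≤ n) (p q : EE n) (hp : ∀ k, 0 ≤ p.2 k) (hq : ∀ k, 0 ≤ q.2 k)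
    (h : PsiN n p = PsiN n q) : p = q := by
  have hK : KK p n = KK q n := by rw [← gridPoly_Psi n hn, ← gridPoly_Psi n hn, h]
  obtain ⟨h1, h2⟩ := contK_inj n dN (sE p) (sE q) (tE p) (tE q) dN_mono
    (fun j _ => tE_nonneg p hp j) (fun j _ => tE_nonneg q hq j) hK
  exact ext_inj p q h1 h2

theorem fS (k : ℕ) : ((k + 1) * (k + 2) : ℝ) / 2 = ∑ j ∈ Finset.range (k + 1), dN j := by
  rw [dN_sum]; push_cast; ring

theorem Psi_kyFan (n : ℕ) (hn : 1 ≤ n) (p : EE n) (hp : ∀ k, 0 ≤ p.2 k) (k : Fin (n - 1))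
    (T : Multiset ℂ) (hT : T ≤ (gridPoly n (PsiN n p).1 (PsiN n p).2).roots)
    (hc : Multiset.card T = k.val + 1) :
    ((k.val + 1) * (k.val + 2) : ℝ) / 2 ≤ (T.map Complex.im).sum ∧
    ((T.map Complex.im).sum = ((k.val + 1) * (k.val + 2) : ℝ) / 2 → p.2 k = 0) := by
  rw [gridPoly_Psi n hn] at hT
  obtain ⟨h1, h2⟩ := kyFan n (sE p) (tE p) dN dN_mono (fun j _ => tE_nonneg p hp j) T hT
  rw [hc, ← fS] at h1
  refine ⟨h1, fun he => ?_⟩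
  have := h2 k (by have := k.2; omega) hc (by rw [hc, ← fS, he])
  simpa [tE] using this

theorem Psi_tight (n : ℕ) (hn : 1 ≤ n) (p : EE n) (k : Fin (n - 1)) (hk : p.2 k = 0) :
    ∃ T : Multiset ℂ, T ≤ (gridPoly n (PsiN n p).1 (PsiN n p).2).roots ∧
      Multiset.card T = k.val + 1 ∧
      (T.map Complex.im).sum = ((k.val + 1) * (k.val + 2) : ℝ) / 2 := by
  refine ⟨(KK p (k.val + 1)).roots, ?_, contK_roots_card _ _ _, ?_⟩
  · rw [gridPoly_Psi n hn]
    obtain ⟨m, hm⟩ := Nat.exists_eq_add_of_le (show k.val + 1 ≤ n by have := k.2; omega)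
    have := tight_of_zero (sE p) dN (tE p) k m (by simp [tE, hk])
    rw [← hm] at this
    exact this
  · rw [fS]; exact contK_roots_im _ _ _ _


noncomputable def dK {n : ℕ} (p v : EE n) : ℕ → ℂ[X]
  | 0 => 0
  | 1 => C ((-sE v 0 : ℝ) : ℂ)
  | (m + 2) => (X - C (aS (sE p) dN (m + 1))) * dK p v (m + 1) - C (tS (tE p) m) * dK p v m
      + C ((-sE v (m + 1) : ℝ) : ℂ) * KK p (m + 1) + C ((-tE v m : ℝ) : ℂ) * KK p m

theorem dK_hasDeriv {n : ℕ} (p v : EE n) (m : ℕ) : ∀ i,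
    HasDerivAt (fun e : ℝ => (KK (p + e • v) m).coeff i) ((dK p v m).coeff i) 0 := by
  have hs : ∀ j, HasDerivAt (fun e : ℝ => aS (sE (p + e • v)) dN j) (sE v j : ℂ) 0 := by
    intro j
    have h0 : HasDerivAt (fun e : ℝ => sE (p + e • v) j) (sE v j) 0 := by
      by_cases h : j < n
      · simp only [sE, dif_pos h, Prod.fst_add, Prod.smul_fst, Pi.add_apply, Pi.smul_apply,
          smul_eq_mul]
        simpa using ((hasDerivAt_id (0 : ℝ)).mul_const (v.1 ⟨j, h⟩)).const_add (p.1 ⟨j, h⟩)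
      · simp only [sE, dif_neg h]; exact hasDerivAt_const _ _
    exact h0.ofReal_comp.add_const _
  have ht : ∀ j, HasDerivAt (fun e : ℝ => tS (tE (p + e • v)) j) (tE v j : ℂ) 0 := by
    intro j
    have h0 : HasDerivAt (fun e : ℝ => tE (p + e • v) j) (tE v j) 0 := by
      by_cases h : j < n - 1
      · simp only [tE, dif_pos h, Prod.snd_add, Prod.smul_snd, Pi.add_apply, Pi.smul_apply,
          smul_eq_mul]
        simpa using ((hasDerivAt_id (0 : ℝ)).mul_const (v.2 ⟨j, h⟩)).const_add (p.2 ⟨j, h⟩)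
      · simp only [tE, dif_neg h]; exact hasDerivAt_const _ _
    exact h0.ofReal_comp
  induction m using Nat.twoStepInduction with
  | zero => intro i; simp only [KK, contK, dK, coeff_zero]; exact hasDerivAt_const _ _
  | one =>
    intro i
    simp only [KK, contK, coeff_sub, coeff_C, dK]
    by_cases h : i = 0
    · simp only [if_pos h]
      push_cast
      exact (hs 0).const_sub _
    · simp only [if_neg h]
      exact hasDerivAt_const _ _
  | more m h1 h2 =>
    intro i
    have hX : HasDerivAt (fun e : ℝ => (X * KK (p + e • v) (m + 1)).coeff i)
        ((X * dK p v (m + 1)).coeff i) 0 := by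
      rcases i with _ | i
      · simp only [coeff_X_mul_zero]; exact hasDerivAt_const _ _
      · simp only [coeff_X_mul]; exact h2 i
    have := (hX.sub ((hs (m + 1)).mul (h2 i))).sub ((ht m).mul (h1 i))
    have hp : p + (0 : ℝ) • v = p := by simp
    simp only [hp] at this
    have hfun : (fun e : ℝ => (KK (p + e • v) (m + 2)).coeff i) =
      (((fun e : ℝ => (X * KK (p + e • v) (m + 1)).coeff i) -
        (fun e : ℝ => aS (sE (p + e • v)) dN (m + 1)) * fun e : ℝ => (KK (p + e • v) (m + 1)).coeff i) -
      (fun e : ℝ => tS (tE (p + e • v)) m) * fun e : ℝ => (KK (p + e • v) m).coeff i) := by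
      funext e
      simp only [KK, contK, sub_mul, coeff_sub, coeff_C_mul, Pi.sub_apply, Pi.mul_apply]
    rw [hfun]
    refine this.congr_deriv ?_
    simp only [dK, sub_mul, coeff_sub, coeff_add, coeff_C_mul]
    push_cast
    ring

theorem Psi_fderiv_inj (n : ℕ) (hn : 1 ≤ n) (p : EE n) (hp : ∀ k, 0 < p.2 k) :
    Function.Injective (fderiv ℝ (PsiN n) p) := by
  rw [injective_iff_map_eq_zero]
  intro v hv
  have hdiff : DifferentiableAt ℝ (PsiN n) p := (Psi_contDiff n).differentiable (by simp) p
  have hline : HasDerivAt (fun e : ℝ => PsiN n (p + e • v)) (0 : EE n) 0 := by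
    have := hdiff.hasFDerivAt.hasLineDerivAt v
    rwa [hv] at this
  have h1 : ∀ k, HasDerivAt (fun e : ℝ => (PsiN n (p + e • v)).1 k) 0 0 := fun k =>
    (hasDerivAt_pi.1 (hline.hasFDerivAt.fst.hasDerivAt)) k |>.congr_deriv (by simp)
  have h2 : ∀ k, HasDerivAt (fun e : ℝ => (PsiN n (p + e • v)).2 k) 0 0 := fun k =>
    (hasDerivAt_pi.1 (hline.hasFDerivAt.snd.hasDerivAt)) k |>.congr_deriv (by simp)
  have hz : dK p v n = 0 := by
    ext i
    have hd := dK_hasDeriv p v n i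
    rw [coeff_zero]
    refine hd.unique ?_
    by_cases hi : i < n
    · have e : ∀ q : EE n, (KK q n).coeff i = (-1 : ℂ) ^ (n - 1 - i + 1) *
          (((PsiN n q).1 ⟨n - 1 - i, by omega⟩ : ℂ) +
            (bExt n (PsiN n q).2 ⟨n - 1 - i, by omega⟩ : ℂ) * Complex.I) := fun q => by
        have := gridPoly_coeff n (PsiN n q).1 (PsiN n q).2 ⟨n - 1 - i, by omega⟩
        rw [gridPoly_Psi n hn] at this
        simp only at this
        rwa [show n - (n - 1 - i + 1) = i by omega] at this
      simp only [e]
      have h3 : HasDerivAt (fun e : ℝ => bExt n (PsiN n (p + e • v)).2 ⟨n - 1 - i, by omega⟩) 0 0 := by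
        unfold bExt
        by_cases h0 : n - 1 - i = 0
        · simp only [dif_pos h0]; exact hasDerivAt_const _ _
        · simp only [dif_neg h0]; exact h2 _
      have := ((h1 ⟨n - 1 - i, by omega⟩).ofReal_comp.add
        (h3.ofReal_comp.mul_const Complex.I)).const_mul ((-1 : ℂ) ^ (n - 1 - i + 1))
      simpa using this
    · have : ∀ q : EE n, (KK q n).coeff i = if i = n then 1 else 0 := by
        intro q
        split_ifs with h
        · rw [h]; exact contK_coeff_self _ _ _
        · exact coeff_eq_zero_of_natDegree_lt (by rw [KK, contK_natDegree]; omega)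
      simp only [this]
      exact hasDerivAt_const _ _
  obtain ⟨b1, b2⟩ := core_poly n (sE p) (sE p) (tE p) (tE p) dN (fun j => -sE v j)
    (fun j => -tE v j) dN_mono (tE_pos p hp) (tE_pos p hp) rfl (dK p v) rfl rfl
    (fun j => rfl) hz
  refine ext_inj v 0 (fun j hj => ?_) (fun j hj => ?_)
  · have := b1 j hj
    simp only [neg_eq_zero] at this
    rw [this]; simp [sE]
  · have := b2 j hj
    simp only [neg_eq_zero] at this
    rw [this]; simp [tE]


theorem Psi_bound (n : ℕ) (hn : 1 ≤ n) (B : ℝ) : ∃ R : ℝ, ∀ p : EE n, (∀ k, 0 ≤ p.2 k) →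
    ‖PsiN n p‖ ≤ B → ‖p‖ ≤ R := by
  have hcomp : ∀ p : EE n, ‖PsiN n p‖ ≤ B → ∀ k, |(PsiN n p).1 k| ≤ B := by
    intro p hp k
    exact (norm_le_pi_norm (PsiN n p).1 k).trans ((norm_fst_le _).trans hp)
  rcases n with _ | _ | m
  · omega
  · refine ⟨B, fun p _ hB => ?_⟩
    have hB0 : 0 ≤ B := (norm_nonneg _).trans hB
    have h0 := hcomp p hB 0
    have e : (PsiN 1 p).1 0 = p.1 0 := by
      simp [PsiN, cmap, KK, contK, aS, sE]
    rw [e] at h0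
    rw [Prod.norm_def]
    refine max_le ((pi_norm_le_iff_of_nonneg hB0).2 fun i => ?_)
      ((pi_norm_le_iff_of_nonneg hB0).2 fun i => ?_)
    · have hi : i = 0 := Fin.ext (by simp)
      rw [hi]; exact h0
    · exact absurd i.2 (by simp)
  · set D : ℝ := ∑ j ∈ Finset.range (m + 2), dN j ^ 2 with hD
    set R : ℝ := B ^ 2 + 2 * B + D with hR
    refine ⟨R + 1, fun p hp hB => ?_⟩
    have hB0 : 0 ≤ B := (norm_nonneg _).trans hB
    have hD0 : 0 ≤ D := Finset.sum_nonneg fun _ _ => sq_nonneg _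
    have hR0 : 0 ≤ R := by positivity
    have h0 := hcomp p hB 0
    have h1 := hcomp p hB 1
    have c0 := gridPoly_coeff (m + 2) (PsiN _ p).1 (PsiN _ p).2 0
    have c1 := gridPoly_coeff (m + 2) (PsiN _ p).1 (PsiN _ p).2 1
    rw [gridPoly_Psi _ hn] at c0 c1
    simp only [Fin.val_zero, Fin.val_one, show m + 2 - (0 + 1) = m + 1 by omega,
      show m + 2 - (1 + 1) = m by omega] at c0 c1
    have h2 := contK_coeff_two (aS (sE p) dN) (tS (tE p)) m
    change (KK p (m + 2)).coeff (m + 1) ^ 2 - 2 * (KK p (m + 2)).coeff m = _ at h2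
    rw [c0, c1] at h2
    have hre := congrArg Complex.re h2
    have hsum : ∑ j ∈ Finset.range (m + 2), sE p j ^ 2 + 2 * ∑ j ∈ Finset.range (m + 1), tE p j
        = (PsiN _ p).1 0 ^ 2 - (bExt _ (PsiN _ p).2 0) ^ 2 - 2 * (PsiN _ p).1 1 + D := by
      have e1 : (∑ j ∈ Finset.range (m + 2), aS (sE p) dN j ^ 2 +
          2 * ∑ j ∈ Finset.range (m + 1), tS (tE p) j).re =
          ∑ j ∈ Finset.range (m + 2), sE p j ^ 2 - D + 2 * ∑ j ∈ Finset.range (m + 1), tE p j := by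
        rw [hD, ← Finset.sum_sub_distrib]
        simp only [Complex.add_re, Complex.re_sum, Complex.mul_re, Complex.re_ofNat,
          Complex.im_ofNat, zero_mul, sub_zero]
        congr 1
        refine Finset.sum_congr rfl fun j _ => ?_
        simp [aS, pow_two]
      rw [e1] at hre
      simp [pow_two] at hre
      simp only [pow_two]
      linarith
    have hle : ∑ j ∈ Finset.range (m + 2), sE p j ^ 2 + 2 * ∑ j ∈ Finset.range (m + 1), tE p j
        ≤ R := by
      rw [hsum, hR]
      have : (PsiN _ p).1 0 ^ 2 ≤ B ^ 2 := sq_le_sq' (abs_le.1 h0).1 (abs_le.1 h0).2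
      have := (abs_le.1 h1).1
      nlinarith [sq_nonneg (bExt _ (PsiN _ p).2 0)]
    have hS0 : 0 ≤ ∑ j ∈ Finset.range (m + 2), sE p j ^ 2 :=
      Finset.sum_nonneg fun _ _ => sq_nonneg _
    have hT0 : 0 ≤ ∑ j ∈ Finset.range (m + 1), tE p j :=
      Finset.sum_nonneg fun _ _ => tE_nonneg p hp _
    rw [Prod.norm_def]
    refine max_le ((pi_norm_le_iff_of_nonneg (by linarith)).2 fun i => ?_)
      ((pi_norm_le_iff_of_nonneg (by linarith)).2 fun i => ?_)
    · have hi : sE p i ^ 2 ≤ ∑ j ∈ Finset.range (m + 2), sE p j ^ 2 :=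
        Finset.single_le_sum (f := fun j => sE p j ^ 2) (fun _ _ => sq_nonneg _)
          (Finset.mem_range.2 i.2)
      have e : sE p i = p.1 i := by simp only [sE]; rw [dif_pos i.2]
      rw [e] at hi
      rw [Real.norm_eq_abs]
      refine abs_le_of_sq_le_sq ?_ (by linarith)
      nlinarith
    · have hi : tE p i ≤ ∑ j ∈ Finset.range (m + 1), tE p j :=
        Finset.single_le_sum (f := fun j => tE p j) (fun _ _ => tE_nonneg p hp _)
          (Finset.mem_range.2 i.2)
      have e : tE p i = p.2 i := by simp only [tE]; rw [dif_pos i.2]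
      rw [e] at hi
      rw [Real.norm_eq_abs, abs_of_nonneg (hp i)]
      linarith

def QQ (n : ℕ) : Set (EE n) := {p | ∀ k, 0 ≤ p.2 k}
def OO (n : ℕ) : Set (EE n) := {p | ∀ k, 0 < p.2 k}

theorem QQ_closed (n : ℕ) : IsClosed (QQ n) := by
  have : QQ n = ⋂ k, {p : EE n | 0 ≤ p.2 k} := by ext; simp [QQ]
  rw [this]
  exact isClosed_iInter fun k => isClosed_le continuous_const (by fun_prop)

theorem Psi_closedEmb (n : ℕ) (hn : 1 ≤ n) :
    Topology.IsClosedEmbedding ((QQ n).domRestrict (PsiN n)) := by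
  have hcont : Continuous (PsiN n) := (Psi_contDiff n).continuous
  have hproper : IsProperMap ((QQ n).domRestrict (PsiN n)) := by
    rw [isProperMap_iff_isCompact_preimage]
    refine ⟨hcont.comp continuous_subtype_val, fun K hK => ?_⟩
    obtain ⟨B, hB⟩ := hK.isBounded.exists_norm_le
    obtain ⟨R, hR⟩ := Psi_bound n hn B
    rw [Subtype.isCompact_iff]
    have e : Subtype.val '' ((QQ n).domRestrict (PsiN n) ⁻¹' K) = QQ n ∩ PsiN n ⁻¹' K := by
      ext p
      constructor
      · rintro ⟨q, hq, rfl⟩; exact ⟨q.2, hq⟩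
      · rintro ⟨h1, h2⟩; exact ⟨⟨p, h1⟩, h2, rfl⟩
    rw [e]
    refine Metric.isCompact_of_isClosed_isBounded
      ((QQ_closed n).inter (hK.isClosed.preimage hcont)) ?_
    refine (Metric.isBounded_closedBall (x := (0 : EE n)) (r := R)).subset ?_
    rintro p ⟨hp, hpK⟩
    rw [mem_closedBall_zero_iff]
    exact hR p hp (hB _ hpK)
  refine Topology.IsClosedEmbedding.of_continuous_injective_isClosedMap hproper.continuous ?_
    hproper.isClosedMap
  rintro ⟨p, hp⟩ ⟨q, hq⟩ h
  exact Subtype.ext (Psi_inj n hn p q hp hq h)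

theorem image_closed (n : ℕ) (hn : 1 ≤ n) : IsClosed (PsiN n '' QQ n) := by
  have := (Psi_closedEmb n hn).isClosed_range
  rwa [Set.range_domRestrict] at this

theorem image_open (n : ℕ) (hn : 1 ≤ n) : IsOpen (PsiN n '' OO n) := by
  have hO : IsOpen (OO n) := by
    have : OO n = ⋂ k, {p : EE n | 0 < p.2 k} := by ext; simp [OO]
    rw [this]
    exact isOpen_iInter_of_finite fun k => isOpen_lt continuous_const (by fun_prop)
  rw [isOpen_iff_mem_nhds]
  rintro _ ⟨p, hp, rfl⟩
  have hst : HasStrictFDerivAt (PsiN n) (fderiv ℝ (PsiN n) p) p :=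
    ((Psi_contDiff n).contDiffAt).hasStrictFDerivAt (by simp)
  have hinj := Psi_fderiv_inj n hn p hp
  have hsurj : Function.Surjective (fderiv ℝ (PsiN n) p) :=
    LinearMap.surjective_of_injective (f := (fderiv ℝ (PsiN n) p).toLinearMap) hinj
  rw [← hst.map_nhds_eq_of_surj (LinearMap.range_eq_top.2 hsurj)]
  exact Filter.image_mem_map (hO.mem_nhds hp)


theorem le_map_exists {α β : Type*} (f : α → β) (Z : Multiset α) : ∀ T : Multiset β,
    T ≤ Z.map f → ∃ T' ≤ Z, T = T'.map f := by
  induction Z using Multiset.induction_on with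
  | empty => intro T hT; exact ⟨0, le_rfl, by simpa using hT⟩
  | cons z Z ih =>
    intro T hT
    rw [Multiset.map_cons] at hT
    by_cases hz : f z ∈ T
    · obtain ⟨T1, rfl⟩ := Multiset.exists_cons_of_mem hz
      obtain ⟨T', hT', rfl⟩ := ih T1 ((Multiset.cons_le_cons_iff _).1 hT)
      exact ⟨z ::ₘ T', (Multiset.cons_le_cons_iff _).2 hT', by simp⟩
    · obtain ⟨T', hT', rfl⟩ := ih T ((Multiset.le_cons_of_notMem hz).1 hT)
      exact ⟨T', hT'.trans (Multiset.le_cons_self _ _), rfl⟩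

/-- the strict version of `permImage` -/
def permInt (n : ℕ) : Set (EE n) :=
  {p | ∀ k : Fin (n - 1), ∀ T : Multiset ℂ,
    T ≤ (gridPoly n p.1 p.2).roots → Multiset.card T = k.val + 1 →
      ((k.val + 1) * (k.val + 2) : ℝ) / 2 < (T.map Complex.im).sum}

noncomputable def phi (n : ℕ) (e : ℝ) (z : ℂ) : ℂ :=
  ((1 - e : ℝ) : ℂ) * z + ((e * ((n + 1 : ℝ) / 2) : ℝ) : ℂ) * Complex.I

theorem phi_im (n : ℕ) (e : ℝ) (T : Multiset ℂ) : ((T.map (phi n e)).map Complex.im).sum =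
    (1 - e) * (T.map Complex.im).sum + e * ((n + 1 : ℝ) / 2) * Multiset.card T := by
  induction T using Multiset.induction_on with
  | empty => simp
  | cons z T ih =>
    rw [Multiset.map_cons, Multiset.map_cons, Multiset.sum_cons, ih]
    simp [phi]
    ring

noncomputable def pathP (n : ℕ) (Z : Multiset ℂ) (e : ℝ) : ℂ[X] :=
  ((Z.map (phi n e)).map fun a => X - C a).prod

theorem pathP_cont (n : ℕ) (Z : Multiset ℂ) : ∀ i, Continuous fun e : ℝ => (pathP n Z e).coeff i := by
  induction Z using Multiset.induction_on with
  | empty => intro i; simp only [pathP, Multiset.map_zero]; exact continuous_const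
  | cons z Z ih =>
    intro i
    have h : ∀ e, pathP n (z ::ₘ Z) e = (X - C (phi n e z)) * pathP n Z e := by
      intro e; simp [pathP]
    simp only [h, sub_mul, coeff_sub, coeff_C_mul]
    have hphi : Continuous fun e : ℝ => phi n e z := by unfold phi; fun_prop
    refine Continuous.sub ?_ (hphi.mul (ih i))
    rcases i with _ | i
    · simp only [coeff_X_mul_zero]; exact continuous_const
    · simp only [coeff_X_mul]; exact ih i

theorem pathC_cont (n : ℕ) (Z : Multiset ℂ) : Continuous fun e : ℝ => cmap n (pathP n Z e) := by
  unfold cmap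
  refine Continuous.prodMk ?_ ?_
  · exact continuous_pi fun k => Complex.continuous_re.comp (continuous_const.mul (pathP_cont n Z _))
  · exact continuous_pi fun k => Complex.continuous_im.comp (continuous_const.mul (pathP_cont n Z _))

theorem pathP_monic (n : ℕ) (Z : Multiset ℂ) (e : ℝ) : (pathP n Z e).Monic :=
  monic_multisetProd_X_sub_C _

theorem pathP_grid (n : ℕ) (hn : 1 ≤ n) (Z : Multiset ℂ) (hc : Multiset.card Z = n)
    (hs : (Z.map Complex.im).sum = (n * (n + 1) : ℝ) / 2) (e : ℝ) :
    gridPoly n (cmap n (pathP n Z e)).1 (cmap n (pathP n Z e)).2 = pathP n Z e := by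
  have hd : (pathP n Z e).natDegree = n := by
    rw [pathP, natDegree_multiset_prod_X_sub_C_eq_card, Multiset.card_map, hc]
  apply gridPoly_cmap
  · exact pathP_monic _ _ _
  · exact hd
  · have h := (IsAlgClosed.splits (pathP n Z e)).nextCoeff_eq_neg_sum_roots_of_monic
      (pathP_monic _ _ _)
    rw [nextCoeff_of_natDegree_pos (by omega), hd] at h
    rw [h, pathP, roots_multiset_prod_X_sub_C, Complex.neg_im, ← map_im_sum, phi_im, hs, hc]
    ring

theorem grid_roots (n : ℕ) (hn : 1 ≤ n) (q : EE n) :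
    Multiset.card (gridPoly n q.1 q.2).roots = n ∧
    ((gridPoly n q.1 q.2).roots.map Complex.im).sum = (n * (n + 1) : ℝ) / 2 := by
  obtain ⟨gm, gd⟩ := gridPoly_monic_deg n q.1 q.2
  refine ⟨by rw [← (IsAlgClosed.splits _).natDegree_eq_card_roots, gd], ?_⟩
  have h := (IsAlgClosed.splits (gridPoly n q.1 q.2)).nextCoeff_eq_neg_sum_roots_of_monic gm
  rw [nextCoeff_of_natDegree_pos (by omega), gd] at h
  have c := gridPoly_coeff n q.1 q.2 ⟨0, hn⟩
  simp only [zero_add] at c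
  rw [h] at c
  have := congrArg Complex.im c
  rw [map_im_sum]
  simpa [bExt] using this

theorem path_zero (n : ℕ) (q : EE n) : cmap n (pathP n (gridPoly n q.1 q.2).roots 0) = q := by
  have : pathP n (gridPoly n q.1 q.2).roots 0 = gridPoly n q.1 q.2 := by
    have hphi : phi n 0 = id := by ext z; simp [phi]
    rw [pathP, hphi, Multiset.map_id]
    exact ((IsAlgClosed.splits _).eq_prod_roots_of_monic (gridPoly_monic_deg n _ _).1).symm
  rw [this, cmap_gridPoly]

theorem path_one (n : ℕ) (Z : Multiset ℂ) (hc : Multiset.card Z = n) :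
    pathP n Z 1 = (X - C ((((n + 1 : ℝ) / 2 : ℝ) : ℂ) * Complex.I)) ^ n := by
  have hphi : phi n 1 = fun _ => (((n + 1 : ℝ) / 2 : ℝ) : ℂ) * Complex.I := by ext z; simp [phi]
  rw [pathP, hphi, Multiset.map_const', Multiset.map_replicate, Multiset.prod_replicate, hc]

theorem path_strict (n : ℕ) (hn : 1 ≤ n) (q : EE n) (hq : q ∈ permImage n) (e : ℝ) (he0 : 0 < e)
    (he1 : e ≤ 1) : cmap n (pathP n (gridPoly n q.1 q.2).roots e) ∈ permInt n := by
  obtain ⟨hc, hs⟩ := grid_roots n hn q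
  intro k T hT hk
  rw [pathP_grid n hn _ hc hs, pathP, roots_multiset_prod_X_sub_C] at hT
  obtain ⟨T', hT', rfl⟩ := le_map_exists _ _ _ hT
  rw [Multiset.card_map] at hk
  rw [phi_im, hk]
  have h1 := hq k T' hT' hk
  have h2 : (k.val : ℝ) + 2 < n + 1 := by
    have := k.2
    have h3 : k.val + 2 < n + 1 := by omega
    exact_mod_cast h3
  have hk0 : (0 : ℝ) ≤ k.val := Nat.cast_nonneg _
  have h4 : ((k.val + 1) * (k.val + 2) : ℝ) / 2 < ((n + 1 : ℝ) / 2) * (k.val + 1) := by nlinarith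
  push_cast
  nlinarith [mul_le_mul_of_nonneg_left h1 (sub_nonneg.2 he1), mul_lt_mul_of_pos_left h4 he0]

theorem permInt_subset (n : ℕ) : permInt n ⊆ permImage n := fun _ h k T hT hk => (h k T hT hk).le

theorem permInt_preconnected (n : ℕ) (hn : 1 ≤ n) : IsPreconnected (permInt n) := by
  refine isPreconnected_of_forall
    (cmap n ((X - C ((((n + 1 : ℝ) / 2 : ℝ) : ℂ) * Complex.I)) ^ n)) ?_
  intro q hq
  refine ⟨(fun e : ℝ => cmap n (pathP n (gridPoly n q.1 q.2).roots e)) '' Set.Icc 0 1, ?_, ?_, ?_, ?_⟩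
  · rintro _ ⟨e, ⟨he0, he1⟩, rfl⟩
    rcases he0.eq_or_lt with rfl | h
    · simp only [path_zero]; exact hq
    · exact path_strict n hn q (permInt_subset n hq) e h he1
  · refine ⟨1, by simp, ?_⟩
    simp only
    rw [path_one n _ (grid_roots n hn q).1]
  · exact ⟨0, by simp, path_zero n q⟩
  · exact isPreconnected_Icc.image _ (pathC_cont n _).continuousOn

theorem permImage_subset_closure (n : ℕ) (hn : 1 ≤ n) : permImage n ⊆ closure (permInt n) := by
  intro q hq
  have ht : Filter.Tendsto (fun e : ℝ => cmap n (pathP n (gridPoly n q.1 q.2).roots e))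
      (nhdsWithin 0 (Set.Ioi 0)) (nhds q) := by
    have := (pathC_cont n (gridPoly n q.1 q.2).roots).tendsto 0
    rw [path_zero] at this
    exact this.mono_left nhdsWithin_le_nhds
  refine mem_closure_of_tendsto ht ?_
  filter_upwards [Ioc_mem_nhdsGT (show (0 : ℝ) < 1 by norm_num)] with e he
  exact path_strict n hn q hq e he.1 he.2

theorem image_eq (n : ℕ) (hn : 1 ≤ n) : PsiN n '' QQ n = permImage n := by
  apply Set.Subset.antisymm
  · rintro _ ⟨p, hp, rfl⟩ k T hT hk
    exact (Psi_kyFan n hn p hp k T hT hk).1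
  · have hOQ : OO n ⊆ QQ n := fun p hp k => (hp k).le
    have hsub : permInt n ⊆ PsiN n '' OO n := by
      refine (permInt_preconnected n hn).subset_of_closure_inter_subset (image_open n hn) ?_ ?_
      · refine ⟨PsiN n (0, fun _ => 1), ?_, ⟨_, fun _ => zero_lt_one, rfl⟩⟩
        intro k T hT hk
        obtain ⟨h1, h2⟩ := Psi_kyFan n hn (0, fun _ => 1) (fun _ => zero_le_one) k T hT hk
        refine lt_of_le_of_ne h1 fun h => ?_
        exact one_ne_zero (h2 h.symm)
      · rintro q ⟨hq1, hq2⟩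
        have : q ∈ PsiN n '' QQ n :=
          closure_minimal (Set.image_mono hOQ) (image_closed n hn) hq1
        obtain ⟨p, hp, rfl⟩ := this
        refine ⟨p, fun k => lt_of_le_of_ne (hp k) fun h => ?_, rfl⟩
        obtain ⟨T, hT, hk, he⟩ := Psi_tight n hn p k h.symm
        exact (hq2 k T hT hk).ne' he
    exact (permImage_subset_closure n hn).trans
      (closure_minimal (hsub.trans (Set.image_mono hOQ)) (image_closed n hn))

end PartTwo

/-- Proposition 12.2: there is a map `Ψ : ℝⁿ × ℝ₊^{n−1} → ℝⁿ × ℝ^{n−1}` which is a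
homeomorphism onto the closed set `S`, smooth with injective differential on the interior,
and under which vanishing of the coordinate `t_k` corresponds to some `k` roots having
imaginary parts summing to exactly `k(k+1)/2`. -/
theorem exists_permutohedron_parametrization (n : ℕ) (hn : 1 ≤ n) :
    ∃ Ψ : ((Fin n → ℝ) × (Fin (n - 1) → ℝ)) → ((Fin n → ℝ) × (Fin (n - 1) → ℝ)),
      IsClosed (permImage n) ∧
      Topology.IsEmbedding
        (({p : (Fin n → ℝ) × (Fin (n - 1) → ℝ) | ∀ k, 0 ≤ p.2 k}).restrict Ψ) ∧
      Ψ '' {p | ∀ k, 0 ≤ p.2 k} = permImage n ∧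
      ContDiffOn ℝ (⊤ : ℕ∞) Ψ {p | ∀ k, 0 < p.2 k} ∧
      (∀ p : (Fin n → ℝ) × (Fin (n - 1) → ℝ), (∀ k, 0 < p.2 k) →
        Function.Injective (fderiv ℝ Ψ p)) ∧
      ∀ p : (Fin n → ℝ) × (Fin (n - 1) → ℝ), (∀ k, 0 ≤ p.2 k) →
        ∀ k : Fin (n - 1),
          (p.2 k = 0 ↔
            ∃ T : Multiset ℂ, T ≤ (gridPoly n (Ψ p).1 (Ψ p).2).roots ∧
              Multiset.card T = k.val + 1 ∧
              (T.map Complex.im).sum = ((k.val + 1) * (k.val + 2) : ℝ) / 2) := by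
  have himg := image_eq n hn
  refine ⟨PsiN n, ?_, (Psi_closedEmb n hn).isEmbedding, himg, (Psi_contDiff n).contDiffOn,
    fun p hp => Psi_fderiv_inj n hn p hp,
    fun p hp k => ⟨fun h => Psi_tight n hn p k h, ?_⟩⟩
  · rw [← himg]; exact image_closed n hn
  · rintro ⟨T, hT, hc, he⟩; exact (Psi_kyFan n hn p hp k T hT hc).2 he
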